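/- arXiv:1910.12484 — 2 statements merged into one kernel-verified Lean document; each statement's English description precedes it below -/
import Mathlib

section
/- Let G be a dihedral group of order 2n where n ≥ 3 is odd. Then 2 + max Δ*_ρ(G) = 2 + max Δ*(G) = 2 + max Δ(G) = c(G) = ω(G) = 2n = D(G) = |G|. -/
namespace ProductOne

open scoped Classical

variable {G : Type*} [Group G]

/-- `S` is a product-one sequence over `G`: its terms can be ordered with product `1`. -/
def IsProductOne (S : Multiset G) : Prop :=
  ∃ l : List G, (l : Multiset G) = S ∧ l.prod = 1

/-- `S` is an atom (a minimal product-one sequence): it is a nontrivial product-one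
sequence that is not the concatenation of two nontrivial product-one sequences. -/
def IsAtomSeq (S : Multiset G) : Prop :=
  S ≠ 0 ∧ IsProductOne S ∧
    ∀ A B : Multiset G, S = A + B → IsProductOne A → IsProductOne B → A = 0 ∨ B = 0

/-- `S` is a sequence over the subset `G₀ ⊆ G`. -/
def SeqOn (G₀ : Set G) (S : Multiset G) : Prop := ∀ g ∈ S, g ∈ G₀

/-- `S` is an atom of the monoid `B(G₀)` of product-one sequences over `G₀`. -/
def IsAtomSeqOn (G₀ : Set G) (S : Multiset G) : Prop := SeqOn G₀ S ∧ IsAtomSeq S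

/-- The set of lengths `L(A)` of factorizations of `A` into atoms over `G₀`. -/
def lengthsOn (G₀ : Set G) (A : Multiset G) : Set ℕ :=
  {k | ∃ f : Multiset (Multiset G), Multiset.card f = k ∧
        (∀ U ∈ f, IsAtomSeqOn G₀ U) ∧ f.sum = A}

/-- The set of lengths `L(A)` over the whole group. -/
def lengths (A : Multiset G) : Set ℕ := lengthsOn Set.univ A

/-- The set of distances of a set `L ⊆ ℕ`. -/
def distancesOf (L : Set ℕ) : Set ℕ :=
  {d | 0 < d ∧ ∃ a, a ∈ L ∧ a + d ∈ L ∧ ∀ b ∈ L, ¬(a < b ∧ b < a + d)}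

/-- The set of distances `Δ(G₀)` of the monoid `B(G₀)`. -/
def DeltaOn (G₀ : Set G) : Set ℕ :=
  {d | ∃ A : Multiset G, SeqOn G₀ A ∧ IsProductOne A ∧ d ∈ distancesOf (lengthsOn G₀ A)}

/-- The set of distances `Δ(G)` of `B(G)`. -/
def Delta (G : Type*) [Group G] : Set ℕ := DeltaOn (Set.univ : Set G)

/-- The large Davenport constant of `G₀`: maximal length of an atom of `B(G₀)`. -/
noncomputable def DavenportOn (G₀ : Set G) : ℕ :=
  sSup {k | ∃ S : Multiset G, IsAtomSeqOn G₀ S ∧ Multiset.card S = k}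

/-- The large Davenport constant `D(G)`. -/
noncomputable def Davenport (G : Type*) [Group G] : ℕ :=
  DavenportOn (Set.univ : Set G)

/-- The small Davenport constant `d(G₀)`: maximal length of a product-one free
sequence over `G₀`. -/
noncomputable def smallDavenportOn (G₀ : Set G) : ℕ :=
  sSup {k | ∃ S : Multiset G, SeqOn G₀ S ∧ Multiset.card S = k ∧
        ∀ T : Multiset G, T ≤ S → T ≠ 0 → ¬IsProductOne T}

/-- `Δ*(G) = {min Δ(G₀) : G₀ ⊆ G with Δ(G₀) ≠ ∅}`. -/
def DeltaStar (G : Type*) [Group G] : Set ℕ :=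
  {d | ∃ G₀ : Set G, (DeltaOn G₀).Nonempty ∧ d = sInf (DeltaOn G₀)}

/-- The elasticity `ρ(L) = max L / min L` of a set of lengths (with the set of
positive elements used, and `ρ = 1` if there are none). -/
noncomputable def elasticity (L : Set ℕ) : ℚ :=
  if (L ∩ {k | 0 < k}).Nonempty then
    ((sSup (L ∩ {k | 0 < k}) : ℕ) : ℚ) / ((sInf (L ∩ {k | 0 < k}) : ℕ) : ℚ)
  else 1

/-- The elasticity `ρ(G₀)` of the monoid `B(G₀)`. -/
noncomputable def rhoOn (G₀ : Set G) : ℝ :=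
  sSup {x : ℝ | ∃ A : Multiset G, SeqOn G₀ A ∧ IsProductOne A ∧
    x = (elasticity (lengthsOn G₀ A) : ℝ)}

/-- `Δ*_ρ(G) = {min Δ(G₀) : G₀ ⊆ G with ρ(G₀) = D(G)/2}`. -/
noncomputable def DeltaRhoStar (G : Type*) [Group G] : Set ℕ :=
  {d | ∃ G₀ : Set G, rhoOn G₀ = (Davenport G : ℝ) / 2 ∧ d = sInf (DeltaOn G₀)}

/-- Divisibility in the monoid `B(G)`. -/
def BDvd (A S : Multiset G) : Prop :=
  ∃ C : Multiset G, IsProductOne C ∧ S = A + C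

/-- The `ω`-invariant `ω(B(G), A)`. -/
noncomputable def omegaAt (A : Multiset G) : ℕ∞ :=
  sInf {N : ℕ∞ | ∀ f : Multiset (Multiset G),
    (∀ B ∈ f, IsProductOne B) → BDvd A f.sum →
    ∃ t ≤ f, (Multiset.card t : ℕ∞) ≤ N ∧ BDvd A t.sum}

/-- `ω(G) = sup {ω(B(G), U) : U an atom of B(G)}`. -/
noncomputable def omegaInv (G : Type*) [Group G] : ℕ∞ :=
  ⨆ U ∈ {U : Multiset G | IsAtomSeq U}, omegaAt U

/-- `z` is a factorization of `A` into atoms. -/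
def IsFactorization (A : Multiset G) (z : Multiset (Multiset G)) : Prop :=
  (∀ U ∈ z, IsAtomSeq U) ∧ z.sum = A

/-- The distance between two factorizations. -/
noncomputable def factDist (z z' : Multiset (Multiset G)) : ℕ :=
  letI := Classical.decEq (Multiset G)
  max (Multiset.card (z - z')) (Multiset.card (z' - z))

/-- The catenary degree `c(A)`. -/
noncomputable def catenaryAt (A : Multiset G) : ℕ∞ :=
  sInf {N : ℕ∞ | ∀ z z' : Multiset (Multiset G),
    IsFactorization A z → IsFactorization A z' →
    Relation.ReflTransGen
      (fun x y => IsFactorization A y ∧ (factDist x y : ℕ∞) ≤ N) z z'}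

/-- The set of positive catenary degrees `Ca(G)`. -/
noncomputable def CatenarySet (G : Type*) [Group G] : Set ℕ∞ :=
  {c | ∃ A : Multiset G, IsProductOne A ∧ catenaryAt A = c ∧ 0 < c}

/-- The catenary degree `c(G)` of `B(G)`. -/
noncomputable def catenaryDegree (G : Type*) [Group G] : ℕ∞ :=
  ⨆ A ∈ {A : Multiset G | IsProductOne A}, catenaryAt A

/-- The cross number `k(S)` of a sequence. -/
noncomputable def crossNumber (S : Multiset G) : ℚ :=
  (S.map fun g => (1 : ℚ) / (orderOf g : ℚ)).sum

/-- The system of sets of lengths `L(G)`. -/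
def LSystem (G : Type*) [Group G] : Set (Set ℕ) :=
  {L | ∃ A : Multiset G, IsProductOne A ∧ L = lengths A}

/-- The set of products `π(S)` of all orderings of the terms of `S`. -/
def piSet (S : Multiset G) : Set G :=
  {g | ∃ l : List G, (l : Multiset G) = S ∧ l.prod = g}

/-- The sumset `{x₁, -x₁} + ⋯ + {x_s, -x_s}` for a sequence `a = x₁ ⋯ x_s`. -/
def signedSums {α : Type*} [AddCommGroup α] (a : Multiset α) : Set α :=
  {z | ∃ t ≤ a, z = t.sum + t.sum - a.sum}

/-- `Σ_k(T)`: the set of sums of `k`-term subsequences of `T`. -/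
def subseqSums {α : Type*} [AddCommMonoid α] (k : ℕ) (T : Multiset α) : Set α :=
  {z | ∃ t ≤ T, Multiset.card t = k ∧ t.sum = z}

/-- The subsequence `S_X` of all terms of `S` lying in `X`. -/
noncomputable def restrictTo (X : Set G) (S : Multiset G) : Multiset G :=
  letI := Classical.decPred fun g => g ∈ X
  S.filter fun g => g ∈ X

/-- The maximum multiplicity `h(S)` of a term of `S`. -/
noncomputable def maxMultiplicity {α : Type*} (S : Multiset α) : ℕ :=
  letI := Classical.decEq α
  S.toFinset.sup S.count

end ProductOne

namespace DihedralOmega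
open scoped Classical

/-- The set of sums of submultisets of `D`. -/
def subSums {α : Type*} [AddCommMonoid α] (D : Multiset α) : Set α := {x | ∃ t ≤ D, t.sum = x}

section Multiset

variable {α β : Type*}

lemma exists_add_of_le_add {D E t : Multiset α} (h : t ≤ D + E) :
    ∃ u v, u ≤ D ∧ v ≤ E ∧ t = u + v := by
  refine ⟨t ∩ D, t - D, Multiset.inter_le_right, ?_, ?_⟩
  · exact Multiset.sub_le_iff_le_add.2 (by rwa [add_comm])
  · rw [add_comm, Multiset.sub_add_inter]

lemma exists_le_of_le_map {f : α → β} {D : Multiset α} {t : Multiset β} (h : t ≤ D.map f) :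
    ∃ u ≤ D, u.map f = t := by
  induction D using Multiset.induction_on generalizing t with
  | empty => exact ⟨0, le_rfl, by simpa using (Multiset.le_zero.1 (by simpa using h)).symm⟩
  | cons a D ih =>
    rw [Multiset.map_cons, ← Multiset.singleton_add] at h
    obtain ⟨u, v, hu, hv, rfl⟩ := exists_add_of_le_add h
    obtain ⟨w, hw, rfl⟩ := ih hv
    rcases Multiset.le_singleton.1 hu with rfl | rfl
    · exact ⟨w, hw.trans (Multiset.le_cons_self _ _), by simp⟩
    · exact ⟨a ::ₘ w, Multiset.cons_le_cons _ hw, by simp⟩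

end Multiset

section SubSums

variable {α ι : Type*} [AddCommGroup α]

lemma zero_mem_subSums (D : Multiset α) : (0 : α) ∈ subSums D := ⟨0, Multiset.zero_le _, rfl⟩

lemma subSums_mono {D E : Multiset α} (h : D ≤ E) : subSums D ⊆ subSums E :=
  fun _ ⟨t, ht, hx⟩ => ⟨t, ht.trans h, hx⟩

lemma mem_subSums_add {D E : Multiset α} {x : α} :
    x ∈ subSums (D + E) ↔ ∃ y ∈ subSums D, ∃ z ∈ subSums E, y + z = x := by
  constructor
  · rintro ⟨t, ht, rfl⟩
    obtain ⟨u, v, hu, hv, rfl⟩ := exists_add_of_le_add ht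
    exact ⟨_, ⟨u, hu, rfl⟩, _, ⟨v, hv, rfl⟩, by simp⟩
  · rintro ⟨_, ⟨u, hu, rfl⟩, _, ⟨v, hv, rfl⟩, rfl⟩
    exact ⟨u + v, add_le_add hu hv, by simp⟩

lemma mem_subSums_cons {a : α} {D : Multiset α} {x : α} :
    x ∈ subSums (a ::ₘ D) ↔ x ∈ subSums D ∨ ∃ y ∈ subSums D, a + y = x := by
  rw [← Multiset.singleton_add, mem_subSums_add]
  constructor
  · rintro ⟨_, ⟨u, hu, rfl⟩, z, hz, rfl⟩
    rcases Multiset.le_singleton.1 hu with rfl | rfl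
    · left; simpa using hz
    · right; exact ⟨z, hz, by simp⟩
  · rintro (h | ⟨y, hy, rfl⟩)
    · exact ⟨0, zero_mem_subSums _, x, h, by simp⟩
    · exact ⟨a, ⟨{a}, le_rfl, by simp⟩, y, hy, rfl⟩

lemma subSums_map {β : Type*} [AddCommGroup β] (f : α →+ β) (D : Multiset α) :
    subSums (D.map f) = f '' subSums D := by
  ext x
  constructor
  · rintro ⟨t, ht, rfl⟩
    obtain ⟨u, hu, rfl⟩ := exists_le_of_le_map ht
    exact ⟨_, ⟨u, hu, rfl⟩, map_multiset_sum f u⟩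
  · rintro ⟨_, ⟨u, hu, rfl⟩, rfl⟩
    exact ⟨u.map f, Multiset.map_le_map hu, (map_multiset_sum f u).symm⟩

lemma subSums_subset_addSubgroup {D : Multiset α} {L : AddSubgroup α} (h : ∀ d ∈ D, d ∈ L) :
    subSums D ⊆ L := by
  rintro _ ⟨t, ht, rfl⟩
  exact L.multiset_sum_mem _ fun d hd => h d (Multiset.mem_of_le ht hd)

/-- The subgroup of periods of a subset of a finite abelian group. -/
def periods [Finite α] (X : Set α) : AddSubgroup α where
  carrier := {g | ∀ x ∈ X, g + x ∈ X}
  zero_mem' := by intro x hx; simpa using hx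
  add_mem' := by
    intro a b ha hb x hx
    rw [add_assoc]
    exact ha _ (hb _ hx)
  neg_mem' := by
    intro a ha x hx
    have key : ∀ k : ℕ, k • a + x ∈ X := by
      intro k
      induction k with
      | zero => simpa using hx
      | succ k ih => rw [succ_nsmul', add_assoc]; exact ha _ ih
    have h1 := key (addOrderOf a - 1)
    have h2 : (addOrderOf a - 1) • a = -a := by
      rw [eq_neg_iff_add_eq_zero, ← succ_nsmul, Nat.sub_add_cancel (addOrderOf_pos a)]
      exact addOrderOf_nsmul_eq_zero a
    rwa [h2] at h1

lemma mem_periods [Finite α] {X : Set α} {g : α} : g ∈ periods X ↔ ∀ x ∈ X, g + x ∈ X := Iff.rfl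

lemma card_periodic [Finite α] {X : Set α} {S : AddSubgroup α} (h : S ≤ periods X) :
    X.ncard = Nat.card S * ((QuotientAddGroup.mk : α → α ⧸ S) '' X).ncard := by
  have hX : X = (QuotientAddGroup.mk : α → α ⧸ S) ⁻¹' ((QuotientAddGroup.mk : α → α ⧸ S) '' X) := by
    refine subset_antisymm (Set.subset_preimage_image _ _) ?_
    rintro x ⟨y, hy, hxy⟩
    have h1 := h (QuotientAddGroup.eq.1 hxy) y hy
    simpa [add_comm, add_assoc] using h1
  conv_lhs => rw [hX]
  rw [← Nat.card_coe_set_eq, ← Nat.card_coe_set_eq,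
    Nat.card_congr (QuotientAddGroup.preimageMkEquivAddSubgroupProdSet S _), Nat.card_prod]

lemma card_succ_le_ncard_image_subSums [Finite α] (D : Multiset α) {E : Multiset α} (hED : E ≤ D)
    (hE : ∀ d ∈ E, d ∉ periods (subSums D)) :
    Multiset.card E + 1 ≤
      ((QuotientAddGroup.mk : α → α ⧸ periods (subSums D)) '' subSums E).ncard := by
  induction E using Multiset.induction_on with
  | empty =>
    have : ((QuotientAddGroup.mk : α → α ⧸ periods (subSums D)) '' subSums 0).Nonempty :=
      ⟨_, 0, zero_mem_subSums _, rfl⟩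
    simpa using Nat.succ_le_of_lt ((Set.ncard_pos (Set.toFinite _)).2 this)
  | cons d E ih =>
    have h1 := ih ((Multiset.le_cons_self _ _).trans hED)
      fun x hx => hE x (Multiset.mem_cons_of_mem hx)
    rw [Multiset.card_cons]
    refine lt_of_le_of_lt h1 (Set.ncard_lt_ncard ?_ (Set.toFinite _))
    refine ⟨Set.image_mono (subSums_mono (Multiset.le_cons_self _ _)), fun hsub => ?_⟩
    refine hE d (Multiset.mem_cons_self _ _) ?_
    obtain ⟨E', hE'⟩ := Multiset.le_iff_exists_add.1 ((Multiset.le_cons_self E d).trans hED)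
    intro y hy
    have hy' := hy
    rw [hE', mem_subSums_add] at hy'
    obtain ⟨x, hx, z, hz, rfl⟩ := hy'
    have hdx : d + x ∈ subSums (d ::ₘ E) := mem_subSums_cons.2 (Or.inr ⟨x, hx, rfl⟩)
    obtain ⟨x', hx', hxx⟩ := hsub ⟨_, hdx, rfl⟩
    have h2 := QuotientAddGroup.eq.1 hxx
    have h3 : x' + z ∈ subSums D := by
      rw [hE', mem_subSums_add]; exact ⟨x', hx', z, hz, rfl⟩
    have h4 := h2 _ h3
    convert h4 using 1
    abel

/-- If a family of nonzero differences has few subset sums, a nonempty subfamily spans a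
nontrivial subgroup by its subset sums. -/
theorem exists_filled_addSubgroup [Finite α] (δ : ι → α) (J : Multiset ι) (h0 : ∀ i ∈ J, δ i ≠ 0)
    (hJ : (subSums (J.map δ)).ncard ≤ Multiset.card J) :
    ∃ I ≤ J, ∃ L : AddSubgroup α, L ≠ ⊥ ∧ subSums (I.map δ) = L := by
  induction hN : Multiset.card J using Nat.strong_induction_on generalizing J with
  | _ N ih =>
    subst hN
    set S := periods (subSums (J.map δ)) with hS
    set Ji := J.filter fun i => δ i ∈ S with hJi
    set Jo := J.filter fun i => ¬ δ i ∈ S with hJo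
    have hsplit : Ji + Jo = J := Multiset.filter_add_not _ _
    have hcard : Multiset.card Ji + Multiset.card Jo = Multiset.card J := by
      rw [← Multiset.card_add, hsplit]
    have hcardX := card_periodic (le_refl (periods (subSums (J.map δ))))
    have hgrow := card_succ_le_ncard_image_subSums (J.map δ)
      (Multiset.map_le_map (Multiset.filter_le (fun i => ¬ δ i ∈ S) J)) (by
        intro d hd
        obtain ⟨i, hi, rfl⟩ := Multiset.mem_map.1 hd
        exact (Multiset.mem_filter.1 hi).2)
    rw [Multiset.card_map] at hgrow
    have hmono : ((QuotientAddGroup.mk : α → α ⧸ S) '' subSums (Jo.map δ)).ncard ≤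
        ((QuotientAddGroup.mk : α → α ⧸ S) '' subSums (J.map δ)).ncard :=
      Set.ncard_le_ncard (Set.image_mono (subSums_mono (Multiset.map_le_map
        (Multiset.filter_le _ _)))) (Set.toFinite _)
    have hSpos : 0 < Nat.card S := Nat.card_pos
    have hSle : Nat.card S * (Multiset.card Jo + 1) ≤ Multiset.card J := by
      calc _ ≤ Nat.card S * _ := Nat.mul_le_mul_left _ (hgrow.trans hmono)
        _ = _ := hcardX.symm
        _ ≤ _ := hJ
    have hSi : Nat.card S ≤ Multiset.card Ji := by nlinarith
    have hin : ∀ d ∈ Ji.map δ, d ∈ S := by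
      intro d hd
      obtain ⟨i, hi, rfl⟩ := Multiset.mem_map.1 hd
      exact (Multiset.mem_filter.1 hi).2
    by_cases hJe : Ji = J
    · refine ⟨J, le_rfl, S, ?_, ?_⟩
      · intro hbot
        obtain ⟨i, hi⟩ : ∃ i, i ∈ Ji :=
          Multiset.card_pos_iff_exists_mem.1 (lt_of_lt_of_le hSpos hSi)
        have := (Multiset.mem_filter.1 hi).2
        rw [hbot, AddSubgroup.mem_bot] at this
        exact h0 i (Multiset.mem_filter.1 hi).1 this
      · refine subset_antisymm ?_ ?_
        · rw [hJe] at hin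
          exact subSums_subset_addSubgroup hin
        · intro s hs
          have := hs 0 (zero_mem_subSums _)
          simpa using this
    · have hlt : Multiset.card Ji < Multiset.card J :=
        Multiset.card_lt_card (lt_of_le_of_ne (Multiset.filter_le _ _) hJe)
      obtain ⟨I, hI, L, hL, hIL⟩ := ih _ hlt Ji
        (fun i hi => h0 i (Multiset.mem_filter.1 hi).1) (by
          refine le_trans ?_ hSi
          rw [← SetLike.coe_sort_coe, Nat.card_coe_set_eq]
          exact Set.ncard_le_ncard (subSums_subset_addSubgroup hin) (Set.toFinite _)) rfl
      exact ⟨I, hI.trans (Multiset.filter_le _ _), L, hL, hIL⟩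

/-- A family whose subset sums, added to `X`, cover a set can be thinned so that every member
enlarges the sumset. -/
lemma exists_thin [Finite α] (δ : ι → α) (D : Multiset α) (J : Multiset ι) :
    ∃ I ≤ J, subSums (D + I.map δ) = subSums (D + J.map δ) ∧
      (subSums D).ncard + Multiset.card I ≤ (subSums (D + J.map δ)).ncard := by
  induction J using Multiset.induction_on with
  | empty => exact ⟨0, le_rfl, rfl, by simp⟩
  | cons j J ih =>
    obtain ⟨I, hI, hIJ, hc⟩ := ih
    by_cases h : subSums (D + (j ::ₘ J).map δ) = subSums (D + J.map δ)
    · exact ⟨I, hI.trans (Multiset.le_cons_self _ _), by rw [h, hIJ], by rw [h]; exact hc⟩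
    · refine ⟨j ::ₘ I, Multiset.cons_le_cons _ hI, ?_, ?_⟩
      · ext x
        simp only [Multiset.map_cons, Multiset.add_cons, mem_subSums_cons, hIJ]
      · have hss : subSums (D + J.map δ) ⊂ subSums (D + (j ::ₘ J).map δ) :=
          lt_of_le_of_ne (subSums_mono (add_le_add le_rfl
            (Multiset.map_le_map (Multiset.le_cons_self _ _)))) (Ne.symm h)
        have := Set.ncard_lt_ncard hss (Set.toFinite _)
        rw [Multiset.card_cons]
        omega

end SubSums
end DihedralOmega

namespace DihedralOmega
open scoped Classical

section Legs

variable {α : Type*}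

/-- The multiset of first and second coordinates of a multiset of pairs. -/
def legs (N : Multiset (α × α)) : Multiset α := N.map Prod.fst + N.map Prod.snd

lemma legs_add (M N : Multiset (α × α)) : legs (M + N) = legs M + legs N := by
  simp only [legs, Multiset.map_add]; abel

lemma legs_cons (p : α × α) (N : Multiset (α × α)) :
    legs (p ::ₘ N) = {p.1} + {p.2} + legs N := by
  simp only [legs, Multiset.map_cons]
  rw [← Multiset.singleton_add, ← Multiset.singleton_add p.2]; abel

lemma card_legs (N : Multiset (α × α)) : Multiset.card (legs N) = 2 * Multiset.card N := by
  simp [legs]; ring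

lemma card_filter_legs_le (p : α → Prop) [DecidablePred p] (J : Multiset (α × α))
    (h : ∀ q ∈ J, ¬ (p q.1 ∧ p q.2)) :
    Multiset.card ((legs J).filter p) ≤ Multiset.card J := by
  induction J using Multiset.induction_on with
  | empty => simp [legs]
  | cons q J ih =>
    have h1 := ih fun x hx => h x (Multiset.mem_cons_of_mem hx)
    have h2 := h q (Multiset.mem_cons_self _ _)
    rw [legs_cons, Multiset.filter_add, Multiset.filter_add, Multiset.card_add, Multiset.card_add,
      Multiset.card_cons, Multiset.filter_singleton, Multiset.filter_singleton]
    by_cases ha : p q.1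
    · have hb : ¬ p q.2 := fun hb => h2 ⟨ha, hb⟩
      simp only [ha, hb, if_true, if_false, Multiset.card_singleton,
        Multiset.empty_eq_zero, Multiset.card_zero]
      omega
    · by_cases hb : p q.2 <;>
      simp only [ha, hb, if_true, if_false, Multiset.card_singleton,
        Multiset.empty_eq_zero, Multiset.card_zero] <;> omega

lemma exists_max_card {β : Type*} (p : Multiset β → Prop) (h0 : p 0) (b : ℕ)
    (hb : ∀ J, p J → Multiset.card J ≤ b) :
    ∃ J, p J ∧ ∀ J', p J' → Multiset.card J' ≤ Multiset.card J := by
  have hmem := Nat.sSup_mem (s := {m | ∃ J, p J ∧ Multiset.card J = m}) ⟨0, 0, h0, by simp⟩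
    ⟨b, by rintro _ ⟨J, hJ, rfl⟩; exact hb J hJ⟩
  obtain ⟨J, hJ, hc⟩ := hmem
  refine ⟨J, hJ, fun J' hJ' => ?_⟩
  rw [hc]
  exact le_csSup ⟨b, by rintro _ ⟨J, hJ, rfl⟩; exact hb J hJ⟩ ⟨J', hJ', rfl⟩

end Legs

section Pool

variable {α ι : Type*} [AddCommGroup α]

/-- The multiset of differences of a multiset of pairs. -/
def diffs (N : Multiset (α × α)) : Multiset α := N.map fun p => p.1 - p.2

lemma diffs_add (M N : Multiset (α × α)) : diffs (M + N) = diffs M + diffs N := by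
  simp [diffs]

/-- Relative form of `exists_filled_addSubgroup`. -/
lemma exists_filled_extension [Finite α] (δ : ι → α) (L : AddSubgroup α) (J : Multiset ι)
    (h0 : ∀ i ∈ J, δ i ∉ L)
    (hJ : ((QuotientAddGroup.mk : α → α ⧸ L) '' subSums (J.map δ)).ncard ≤ Multiset.card J) :
    ∃ I ≤ J, ∃ L' : AddSubgroup α, L < L' ∧ (∀ i ∈ I, δ i ∈ L') ∧
      ∀ x ∈ L', ∃ t ≤ I, x - (t.map δ).sum ∈ L := by
  have himg : subSums (J.map fun i => QuotientAddGroup.mk' L (δ i)) =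
      (QuotientAddGroup.mk : α → α ⧸ L) '' subSums (J.map δ) := by
    have := subSums_map (QuotientAddGroup.mk' L) (J.map δ)
    rwa [Multiset.map_map] at this
  obtain ⟨I, hI, M, hM, hIM⟩ := exists_filled_addSubgroup
    (fun i => QuotientAddGroup.mk' L (δ i)) J
    (fun i hi h => h0 i hi ((QuotientAddGroup.eq_zero_iff _).1 h)) (by rw [himg]; exact hJ)
  refine ⟨I, hI, M.comap (QuotientAddGroup.mk' L), ?_, ?_, ?_⟩
  · refine lt_of_le_of_ne ?_ ?_
    · intro x hx
      have : (QuotientAddGroup.mk' L x) = 0 := (QuotientAddGroup.eq_zero_iff _).2 hx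
      rw [AddSubgroup.mem_comap, this]; exact M.zero_mem
    · intro h
      apply hM
      rw [AddSubgroup.eq_bot_iff_forall]
      intro y hy
      obtain ⟨x, rfl⟩ := QuotientAddGroup.mk'_surjective L y
      have : x ∈ L := by rw [h]; exact hy
      exact (QuotientAddGroup.eq_zero_iff _).2 this
  · intro i hi
    rw [AddSubgroup.mem_comap, ← SetLike.mem_coe, ← hIM]
    exact ⟨{QuotientAddGroup.mk' L (δ i)}, Multiset.singleton_le.2
      (Multiset.mem_map_of_mem _ hi), by simp⟩
  · intro x hx
    rw [AddSubgroup.mem_comap, ← SetLike.mem_coe, ← hIM] at hx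
    obtain ⟨t, ht, htx⟩ := hx
    obtain ⟨u, hu, rfl⟩ := exists_le_of_le_map ht
    refine ⟨u, hu, ?_⟩
    rw [← QuotientAddGroup.eq_zero_iff, QuotientAddGroup.mk_sub, sub_eq_zero]
    change QuotientAddGroup.mk' L x = QuotientAddGroup.mk' L _
    rw [← htx, map_multiset_sum, Multiset.map_map]
    rfl

lemma sum_mem_of_forall {D : Multiset α} {L : AddSubgroup α} (h : ∀ d ∈ D, d ∈ L) : D.sum ∈ L :=
  L.multiset_sum_mem _ h

lemma mem_of_subSums_eq {D : Multiset α} {L : AddSubgroup α} (h : subSums D = L) {d : α}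
    (hd : d ∈ D) : d ∈ L := by
  rw [← SetLike.mem_coe, ← h]
  exact ⟨{d}, Multiset.singleton_le.2 hd, by simp⟩

lemma card_filter_le_card_addSubgroup [Finite α] {R : Multiset α}
    (hR : ∀ R' ≤ R, Multiset.card R' + 1 ≤ (subSums R').ncard) (L : AddSubgroup α) :
    Multiset.card (R.filter (· ∈ L)) + 1 ≤ Nat.card L := by
  refine (hR _ (Multiset.filter_le _ _)).trans ?_
  rw [← SetLike.coe_sort_coe, Nat.card_coe_set_eq]
  exact Set.ncard_le_ncard (subSums_subset_addSubgroup fun d hd => (Multiset.mem_filter.1 hd).2)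
    (Set.toFinite _)

lemma odd_index_ge_three {L₁ L : AddSubgroup α} [Finite α] (h : L₁ < L) (hodd : Odd (Nat.card L)) :
    ∃ b, 3 ≤ b ∧ Nat.card L = b * Nat.card L₁ := by
  obtain ⟨b, hb⟩ := AddSubgroup.card_dvd_of_le h.le
  rw [mul_comm] at hb
  refine ⟨b, ?_, hb⟩
  have hbo : Odd b := by rw [hb] at hodd; exact (Nat.odd_mul.1 hodd).1
  have hb1 : b ≠ 1 := by
    rintro rfl
    rw [one_mul] at hb
    exact h.ne (AddSubgroup.eq_of_le_of_card_ge h.le hb.le)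
  obtain ⟨k, rfl⟩ := hbo
  omega

/-- Maximal families of disjoint pairs that are incongruent modulo `L`: up to one leg of each
pair, everything lies in one class, as soon as two elements are left over. -/
lemma exists_pairs_one_class (F : Multiset α) (L : AddSubgroup α) :
    ∃ J : Multiset (α × α), legs J ≤ F ∧ (∀ q ∈ J, q.1 - q.2 ∉ L) ∧
      (2 * Multiset.card J + 2 ≤ Multiset.card F → ∃ c ∈ F,
        Multiset.card (F.filter fun x => x - c ∉ L) ≤ Multiset.card J) := by
  obtain ⟨J, ⟨hJF, hJL⟩, hmax⟩ := exists_max_card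
    (fun J : Multiset (α × α) => legs J ≤ F ∧ ∀ q ∈ J, q.1 - q.2 ∉ L)
    ⟨by simp [legs], by simp⟩ (Multiset.card F) (by
      rintro J ⟨h, -⟩
      have := Multiset.card_le_card h
      rw [card_legs] at this
      omega)
  refine ⟨J, hJF, hJL, fun hcard => ?_⟩
  obtain ⟨E, rfl⟩ := Multiset.le_iff_exists_add.1 hJF
  rw [Multiset.card_add, card_legs] at hcard
  have hone : ∀ x y, {x} + {y} ≤ E → x - y ∈ L := by
    intro x y hxy
    by_contra hn
    have := hmax ((x, y) ::ₘ J) ⟨by rw [legs_cons, add_comm]; exact add_le_add le_rfl hxy, by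
      intro q hq
      rcases Multiset.mem_cons.1 hq with rfl | hq
      · exact hn
      · exact hJL q hq⟩
    rw [Multiset.card_cons] at this
    omega
  obtain ⟨c, hc⟩ : ∃ c, c ∈ E := Multiset.card_pos_iff_exists_mem.1 (by omega)
  obtain ⟨E', rfl⟩ := Multiset.exists_cons_of_mem hc
  rw [Multiset.card_cons] at hcard
  obtain ⟨d, hd⟩ : ∃ d, d ∈ E' := Multiset.card_pos_iff_exists_mem.1 (by omega)
  obtain ⟨E'', rfl⟩ := Multiset.exists_cons_of_mem hd
  have hdc : d - c ∈ L := hone d c (by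
    rw [add_comm, ← Multiset.singleton_add, ← Multiset.singleton_add, ← add_assoc]
    exact Multiset.le_add_right _ _)
  refine ⟨c, by simp, ?_⟩
  have hE : ((c ::ₘ d ::ₘ E'').filter fun x => x - c ∉ L) = 0 := by
    rw [Multiset.filter_eq_nil]
    intro x hx
    rw [not_not]
    rcases Multiset.mem_cons.1 hx with rfl | hx
    · simp [L.zero_mem]
    · refine hone x c ?_
      rw [← Multiset.singleton_add, add_comm]
      exact add_le_add le_rfl (Multiset.singleton_le.2 hx)
  rw [Multiset.filter_add, hE, add_zero]
  refine card_filter_legs_le _ J ?_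
  rintro ⟨a, b⟩ hq ⟨ha, hb⟩
  obtain ⟨J', rfl⟩ := Multiset.exists_cons_of_mem hq
  simp only at ha hb
  have := hmax ((a, c) ::ₘ (b, d) ::ₘ J') ⟨by
    rw [legs_cons, legs_cons, legs_cons]
    simp only
    have e : ({a} + {b} + legs J' + (c ::ₘ d ::ₘ E'') : Multiset α) =
      {a} + {c} + ({b} + {d} + legs J') + E'' := by
      rw [← Multiset.singleton_add, ← Multiset.singleton_add]; abel
    rw [e]; exact Multiset.le_add_right _ _, by
    intro q hq
    rcases Multiset.mem_cons.1 hq with rfl | hq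
    · exact ha
    rcases Multiset.mem_cons.1 hq with rfl | hq
    · intro h
      refine hb ?_
      have := L.add_mem h hdc
      simpa using this
    · exact hJL q (Multiset.mem_cons_of_mem hq)⟩
  simp only [Multiset.card_cons] at this
  omega

end Pool
end DihedralOmega

namespace DihedralOmega
open scoped Classical

section Robust

variable {α : Type*} [AddCommGroup α]

lemma ncard_coe_addSubgroup (L : AddSubgroup α) : (L : Set α).ncard = Nat.card L := by
  rw [← Nat.card_coe_set_eq]; rfl

variable [Finite α]

/-- A long sequence in a group `L` of odd order either spans `L` by the subset sums of its
rotations and of differences of disjoint pairs of reflections, or is concentrated on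
a proper subgroup. -/
lemma filled_or_concentrated (L : AddSubgroup α) (hodd : Odd (Nat.card L)) (F R : Multiset α)
    (hFL : ∀ x ∈ F, x ∈ L) (hRL : ∀ x ∈ R, x ∈ L)
    (hR : ∀ R' ≤ R, Multiset.card R' + 1 ≤ (subSums R').ncard)
    (hsize : 2 * Nat.card L ≤ Multiset.card F + Multiset.card R + 1) :
    (∃ N, legs N ≤ F ∧ subSums (R + diffs N) = L) ∨
      ∃ L₁ < L, ∃ c ∈ L, Multiset.card (F.filter fun x => x - c ∉ L₁) +
        Multiset.card (R.filter fun x => x ∉ L₁) + Nat.card L₁ ≤ Nat.card L := by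
  have hlegs : ∀ N : Multiset (α × α), legs N ≤ F → ∀ d ∈ diffs N, d ∈ L := by
    intro N hN d hd
    obtain ⟨q, hq, rfl⟩ := Multiset.mem_map.1 hd
    exact L.sub_mem
      (hFL _ (Multiset.mem_of_le hN (Multiset.mem_add.2 (Or.inl (Multiset.mem_map_of_mem _ hq)))))
      (hFL _ (Multiset.mem_of_le hN (Multiset.mem_add.2 (Or.inr (Multiset.mem_map_of_mem _ hq)))))
  obtain ⟨L₁, ⟨Np, Nr, hNp, hNr, hNL⟩, hmax⟩ := WellFounded.has_min
    (wellFounded_gt (α := AddSubgroup α))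
    {L₁ | ∃ Np Nr, legs Np ≤ F ∧ Nr ≤ R ∧ subSums (Nr + diffs Np) = L₁}
    ⟨⊥, 0, 0, by simp [legs], by simp, by
      ext x
      simp [diffs, subSums, eq_comm]⟩
  have hL₁L : L₁ ≤ L := by
    intro x hx
    rw [← SetLike.mem_coe, ← hNL] at hx
    refine subSums_subset_addSubgroup ?_ hx
    intro d hd
    rcases Multiset.mem_add.1 hd with hd | hd
    · exact hRL d (Multiset.mem_of_le hNr hd)
    · exact hlegs Np hNp d hd
  rw [le_iff_eq_or_lt] at hL₁L
  rcases hL₁L with rfl | hlt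
  · left
    refine ⟨Np, hNp, subset_antisymm (subSums_subset_addSubgroup ?_) ?_⟩
    · intro d hd
      rcases Multiset.mem_add.1 hd with hd | hd
      · exact hRL d hd
      · exact hlegs Np hNp d hd
    · rw [← hNL]
      exact subSums_mono (add_le_add hNr le_rfl)
  by_contra hcon
  push Not at hcon
  obtain ⟨hnofill, hnoconc⟩ := hcon
  -- thin the family of pairs
  obtain ⟨Ip, hIp, hIeq, hIcard⟩ := exists_thin (fun p : α × α => p.1 - p.2) Nr Np
  replace hIeq : subSums (Nr + diffs Ip) = L₁ := hIeq.trans hNL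
  replace hIcard : (subSums Nr).ncard + Multiset.card Ip ≤ Nat.card L₁ := by
    rw [← ncard_coe_addSubgroup, ← hNL]; exact hIcard
  have hIF : legs Ip ≤ F := by
    obtain ⟨N', rfl⟩ := Multiset.le_iff_exists_add.1 hIp
    rw [legs_add] at hNp
    exact (Multiset.le_add_right _ _).trans hNp
  have hNr1 : 1 ≤ (subSums Nr).ncard := by
    have := hR Nr hNr
    omega
  obtain ⟨F', rfl⟩ := Multiset.le_iff_exists_add.1 hIF
  obtain ⟨Jp, hJF, hJL, hJc⟩ := exists_pairs_one_class F' L₁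
  set Jr := R.filter fun x => x ∉ L₁ with hJr
  let δ : (α × α) ⊕ α → α := Sum.elim (fun p => p.1 - p.2) id
  have hδ : ∀ (A : Multiset (α × α)) (B : Multiset α),
      (A.map Sum.inl + B.map Sum.inr).map δ = diffs A + B := by
    intro A B
    simp [δ, diffs, Function.comp_def]
  set J : Multiset ((α × α) ⊕ α) := Jp.map Sum.inl + Jr.map Sum.inr with hJ
  have hJcard : Multiset.card J = Multiset.card Jp + Multiset.card Jr := by simp [hJ]
  have hNrL : Nr + Jr ≤ R := by
    calc Nr + Jr ≤ R.filter (fun x => x ∈ L₁) + Jr := by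
          refine add_le_add (Multiset.le_filter.2 ⟨hNr, fun a ha => ?_⟩) le_rfl
          exact mem_of_subSums_eq hNL (Multiset.mem_add.2 (Or.inl ha))
      _ = R := Multiset.filter_add_not _ _
  have hgrow : Multiset.card J + 1 ≤
      ((QuotientAddGroup.mk : α → α ⧸ L₁) '' subSums (J.map δ)).ncard := by
    by_contra hlt'
    obtain ⟨I, hI, L₂, hL₂, hIL, hfill⟩ := exists_filled_extension δ L₁ J (by
      intro i hi
      rcases Multiset.mem_add.1 hi with hi | hi
      · obtain ⟨q, hq, rfl⟩ := Multiset.mem_map.1 hi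
        exact hJL q hq
      · obtain ⟨q, hq, rfl⟩ := Multiset.mem_map.1 hi
        exact (Multiset.mem_filter.1 hq).2) (by omega)
    obtain ⟨u, v, hu, hv, rfl⟩ := exists_add_of_le_add hI
    obtain ⟨A, hA, rfl⟩ := exists_le_of_le_map hu
    obtain ⟨B, hB, rfl⟩ := exists_le_of_le_map hv
    refine hmax L₂ ⟨Ip + A, Nr + B, ?_, ?_, ?_⟩ hL₂
    · obtain ⟨A', rfl⟩ := Multiset.le_iff_exists_add.1 hA
      rw [legs_add] at hJF ⊢
      exact add_le_add le_rfl ((Multiset.le_add_right _ _).trans hJF)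
    · exact (add_le_add le_rfl hB).trans hNrL
    · have e : Nr + B + diffs (Ip + A) = (Nr + diffs Ip) + (diffs A + B) := by
        rw [diffs_add]; abel
      rw [e]
      refine subset_antisymm (subSums_subset_addSubgroup ?_) ?_
      · intro d hd
        rcases Multiset.mem_add.1 hd with hd | hd
        · exact hL₂.le (mem_of_subSums_eq hIeq hd)
        · rw [← hδ] at hd
          obtain ⟨i, hi, rfl⟩ := Multiset.mem_map.1 hd
          exact hIL i hi
      · intro x hx
        obtain ⟨t, ht, hxt⟩ := hfill x hx
        rw [mem_subSums_add]
        rw [← SetLike.mem_coe, ← hIeq] at hxt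
        refine ⟨_, hxt, (t.map δ).sum, ⟨t.map δ, ?_, rfl⟩, by abel⟩
        rw [← hδ]
        exact Multiset.map_le_map ht
  have hJsub : ∀ d ∈ (Nr + diffs Ip) + J.map δ, d ∈ L := by
    intro d hd
    rw [hJ, hδ] at hd
    rcases Multiset.mem_add.1 hd with hd | hd
    · rcases Multiset.mem_add.1 hd with hd | hd
      · exact hRL d (Multiset.mem_of_le hNr hd)
      · exact hlegs Ip hIF d hd
    · rcases Multiset.mem_add.1 hd with hd | hd
      · exact hlegs Jp (hJF.trans (Multiset.le_add_left _ _)) d hd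
      · exact hRL d (Multiset.mem_of_le (Multiset.filter_le _ _) hd)
  have hXlt : (subSums ((Nr + diffs Ip) + J.map δ)).ncard < Nat.card L := by
    rw [← ncard_coe_addSubgroup]
    refine Set.ncard_lt_ncard ⟨subSums_subset_addSubgroup hJsub, fun hsub => ?_⟩ (Set.toFinite _)
    have hlegsN : legs (Ip + Jp) ≤ legs Ip + F' := by
      rw [legs_add]; exact add_le_add le_rfl hJF
    refine hnofill (Ip + Jp) hlegsN (subset_antisymm (subSums_subset_addSubgroup ?_) ?_)
    · intro d hd
      rcases Multiset.mem_add.1 hd with hd | hd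
      · exact hRL d hd
      · exact hlegs _ hlegsN d hd
    · refine hsub.trans (subSums_mono ?_)
      rw [hJ, hδ, diffs_add]
      calc Nr + diffs Ip + (diffs Jp + Jr) = (Nr + Jr) + (diffs Ip + diffs Jp) := by abel
        _ ≤ _ := add_le_add hNrL le_rfl
  have hper : L₁ ≤ periods (subSums ((Nr + diffs Ip) + J.map δ)) := by
    intro g hg x hx
    rw [mem_subSums_add, hIeq] at hx ⊢
    obtain ⟨y, hy, z, hz, rfl⟩ := hx
    exact ⟨g + y, L₁.add_mem hg hy, z, hz, by abel⟩
  have hcardX := card_periodic hper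
  have hmono : ((QuotientAddGroup.mk : α → α ⧸ L₁) '' subSums (J.map δ)).ncard ≤
      ((QuotientAddGroup.mk : α → α ⧸ L₁) '' subSums ((Nr + diffs Ip) + J.map δ)).ncard :=
    Set.ncard_le_ncard (Set.image_mono (subSums_mono (Multiset.le_add_left _ _))) (Set.toFinite _)
  obtain ⟨b, hb, hbL⟩ := odd_index_ge_three hlt hodd
  have hpos : 0 < Nat.card L₁ := Nat.card_pos
  have hJb : Multiset.card J + 2 ≤ b := by
    have h1 : Nat.card L₁ * (Multiset.card J + 1) < b * Nat.card L₁ := by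
      rw [← hbL]
      refine lt_of_le_of_lt ?_ hXlt
      rw [hcardX]
      exact Nat.mul_le_mul_left _ (hgrow.trans hmono)
    rw [mul_comm b] at h1
    have := lt_of_mul_lt_mul_left h1 (Nat.zero_le _)
    omega
  have hRsplit : Multiset.card (R.filter fun x => x ∈ L₁) + Multiset.card Jr = Multiset.card R := by
    rw [← Multiset.card_add, hJr, Multiset.filter_add_not]
  have hr₁ := card_filter_le_card_addSubgroup hR L₁
  have hprod : 3 * Nat.card L₁ + b ≤ b * Nat.card L₁ + 3 := by nlinarith
  rw [Multiset.card_add, card_legs] at hsize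
  obtain ⟨c, hc, hcc⟩ := hJc (by nlinarith)
  refine absurd (hnoconc L₁ hlt c (hFL c (Multiset.mem_add.2 (Or.inr hc)))) (not_lt.2 ?_)
  rw [Multiset.filter_add, Multiset.card_add]
  have h2 := Multiset.card_le_card (Multiset.filter_le (fun x => x - c ∉ L₁) (legs Ip))
  rw [card_legs] at h2
  change _ + Multiset.card Jr + _ ≤ _
  omega

end Robust
end DihedralOmega

namespace DihedralOmega
open scoped Classical

section Robust

variable {α : Type*}

lemma exists_le_card_eq (s : Multiset α) {m : ℕ} (h : m ≤ Multiset.card s) :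
    ∃ t ≤ s, Multiset.card t = m := by
  induction s using Quotient.inductionOn with
  | _ l => exact ⟨(l.take m : List α), (List.take_sublist m l).subperm, by
      simp at h ⊢; exact h⟩

variable [AddCommGroup α]

/-- Every subset sum of the rotations and of the differences of reflections with `c`, shifted
by an element of `L`, is attained by choosing `k` reflections and some of the rotations. -/
def IsRobust (F R : Multiset α) (k : ℕ) (L : AddSubgroup α) (c : α) : Prop :=
  ∀ t ≤ F.map (· - c) + R, ∀ h ∈ L, ∃ P ≤ F, Multiset.card P = k ∧ ∃ B ≤ R,
    P.sum + B.sum = k • c + t.sum + h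

lemma sum_map_sub_const (M : Multiset α) (c : α) :
    (M.map (· - c)).sum = M.sum - Multiset.card M • c := by
  rw [Multiset.sum_map_sub]; simp

lemma isRobust_of_pairs {F R : Multiset α} {k : ℕ} {L : AddSubgroup α} {c : α}
    (hF : Multiset.card F = 2 * k) {N : Multiset (α × α)}
    (hN : legs N ≤ F.filter fun x => x - c ∈ L)
    (hfill : subSums (R.filter (fun x => x ∈ L) + diffs N) = L)
    (hdom : Multiset.card (F.filter fun x => x - c ∉ L) + 2 * Multiset.card N ≤
      Multiset.card (F.filter fun x => x - c ∈ L)) : IsRobust F R k L c := by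
  intro t ht h hh
  obtain ⟨u, tR, hu, htR, rfl⟩ := exists_add_of_le_add ht
  obtain ⟨tF, htF, rfl⟩ := exists_le_of_le_map hu
  set A := tF.filter fun x => x - c ∉ L with hA
  set A' := tF.filter fun x => x - c ∈ L with hA'
  set B := tR.filter fun x => x ∉ L with hB
  set B' := tR.filter fun x => x ∈ L with hB'
  have hAA : A' + A = tF := Multiset.filter_add_not _ _
  have hBB : B' + B = tR := Multiset.filter_add_not _ _
  set Fo := F.filter fun x => x - c ∉ L with hFo
  have hFF : (F.filter fun x => x - c ∈ L) + Fo = F := Multiset.filter_add_not _ _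
  obtain ⟨E, hE⟩ := Multiset.le_iff_exists_add.1 hN
  have hAFo : A ≤ Fo := Multiset.filter_le_filter _ htF
  have hAc := Multiset.card_le_card hAFo
  have hc1 : Multiset.card (F.filter fun x => x - c ∈ L) + Multiset.card Fo = 2 * k := by
    rw [← Multiset.card_add, hFF, hF]
  have hc2 : 2 * Multiset.card N + Multiset.card E =
      Multiset.card (F.filter fun x => x - c ∈ L) := by
    rw [hE, Multiset.card_add, card_legs]
  obtain ⟨E₁, hE₁, hE₁c⟩ := exists_le_card_eq E
    (m := k - Multiset.card N - Multiset.card A) (by omega)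
  have hmemL : ∀ M : Multiset α, M ≤ F.filter (fun x => x - c ∈ L) → (M.map (· - c)).sum ∈ L := by
    intro M hM
    refine L.multiset_sum_mem _ fun d hd => ?_
    obtain ⟨x, hx, rfl⟩ := Multiset.mem_map.1 hd
    exact (Multiset.mem_filter.1 (Multiset.mem_of_le hM hx)).2
  have hz : (A'.map (· - c)).sum + B'.sum + h - (E₁.map (· - c)).sum -
      ((N.map Prod.snd).map (· - c)).sum ∈ L := by
    refine L.sub_mem (L.sub_mem (L.add_mem (L.add_mem ?_ ?_) hh) ?_) ?_
    · exact hmemL _ (Multiset.filter_le_filter _ htF)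
    · exact L.multiset_sum_mem _ fun d hd => (Multiset.mem_filter.1 hd).2
    · exact hmemL _ (by rw [hE]; exact hE₁.trans (Multiset.le_add_left _ _))
    · exact hmemL _ ((Multiset.le_add_left _ _).trans hN)
  rw [← SetLike.mem_coe, ← hfill, mem_subSums_add] at hz
  obtain ⟨_, ⟨u, hu, rfl⟩, _, ⟨v, hv, rfl⟩, huv⟩ := hz
  obtain ⟨N₂, hN₂, rfl⟩ := exists_le_of_le_map hv
  obtain ⟨N₃, rfl⟩ := Multiset.le_iff_exists_add.1 hN₂
  refine ⟨A + E₁ + (N₂.map Prod.fst + N₃.map Prod.snd), ?_, ?_, B + u, ?_, ?_⟩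
  · calc A + E₁ + (N₂.map Prod.fst + N₃.map Prod.snd)
        ≤ Fo + E + (legs N₂ + legs N₃) := by
          refine add_le_add (add_le_add hAFo hE₁) (add_le_add ?_ ?_)
          · exact Multiset.le_add_right _ _
          · exact Multiset.le_add_left _ _
      _ = F := by rw [← legs_add, ← hFF, hE]; abel
  · simp only [Multiset.card_add, Multiset.card_map] at *
    omega
  · calc B + u ≤ R.filter (fun x => x ∉ L) + R.filter (fun x => x ∈ L) :=
          add_le_add (Multiset.filter_le_filter _ htR) hu
      _ = R := by rw [add_comm]; exact Multiset.filter_add_not _ _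
  · have hk : k = Multiset.card A + Multiset.card E₁ + (Multiset.card N₂ + Multiset.card N₃) := by
      simp only [Multiset.card_add] at *
      omega
    simp only [Multiset.map_add, Multiset.sum_add, sum_map_sub_const, Multiset.sum_map_sub,
      Multiset.card_map] at huv ⊢
    rw [← hAA, ← hBB, hk]
    simp only [Multiset.card_add, Multiset.sum_add, add_smul] at huv ⊢
    have hu' := eq_sub_of_add_eq huv
    rw [hu']
    abel

/-- A robust subgroup stays robust after enlarging it by subset sums of exceptional elements. -/
lemma IsRobust.extend {F R : Multiset α} {k : ℕ} {L L' : AddSubgroup α} {c : α}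
    (hrob : IsRobust F R k L c) {I : Multiset α} (hI : I ≤ F.map (· - c) + R)
    (hIL : ∀ i ∈ I, i ∈ L') (hfill : ∀ x ∈ L', ∃ t ≤ I, x - t.sum ∈ L) :
    IsRobust F R k L' c := by
  intro t ht h hh
  set D := F.map (· - c) + R
  have hts : t.filter (fun x => x ∈ L') + t.filter (fun x => x ∉ L') = t :=
    Multiset.filter_add_not _ _
  have htin : (t.filter fun x => x ∈ L').sum ∈ L' :=
    L'.multiset_sum_mem _ fun d hd => (Multiset.mem_filter.1 hd).2
  obtain ⟨i, hi, hiL⟩ := hfill _ (L'.add_mem htin hh)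
  obtain ⟨P, hP, hPk, B, hB, hsum⟩ := hrob (i + t.filter fun x => x ∉ L') (by
    calc i + t.filter (fun x => x ∉ L') ≤ D.filter (fun x => x ∈ L') + D.filter (fun x => x ∉ L') :=
          add_le_add (Multiset.le_filter.2 ⟨hi.trans hI,
            fun a ha => hIL a (Multiset.mem_of_le hi ha)⟩) (Multiset.filter_le_filter _ ht)
      _ = D := Multiset.filter_add_not _ _) _ hiL
  refine ⟨P, hP, hPk, B, hB, hsum.trans ?_⟩
  conv_rhs => rw [← hts]
  simp only [Multiset.sum_add]
  abel

variable [Finite α]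

theorem exists_isRobust (hodd : Odd (Nat.card α)) {F R : Multiset α} {k : ℕ}
    (hF : Multiset.card F = 2 * k)
    (hR : ∀ R' ≤ R, Multiset.card R' + 1 ≤ (subSums R').ncard)
    (hsize : 2 * Nat.card α ≤ Multiset.card F + Multiset.card R + 1) :
    ∃ L c, IsRobust F R k L c := by
  obtain ⟨L, ⟨c, hc⟩, hmin⟩ := WellFounded.has_min (wellFounded_lt (α := AddSubgroup α))
    {L | ∃ c, Multiset.card (F.filter fun x => x - c ∉ L) +
      Multiset.card (R.filter fun x => x ∉ L) + Nat.card L ≤ Nat.card α}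
    ⟨⊤, 0, by simp⟩
  have hLodd : Odd (Nat.card L) := Odd.of_dvd_nat hodd (AddSubgroup.card_addSubgroup_dvd_card L)
  have hLle : Nat.card L ≤ Nat.card α := Nat.le_of_dvd Nat.card_pos
    (AddSubgroup.card_addSubgroup_dvd_card L)
  set Fi := F.filter fun x => x - c ∈ L with hFi
  set Fo := F.filter fun x => x - c ∉ L with hFo
  set Ri := R.filter fun x => x ∈ L with hRi
  set Ro := R.filter fun x => x ∉ L with hRo
  have hFF : Fi + Fo = F := Multiset.filter_add_not _ _
  have hRR : Ri + Ro = R := Multiset.filter_add_not _ _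
  have hFc : Multiset.card Fi + Multiset.card Fo = Multiset.card F := by
    rw [← Multiset.card_add, hFF]
  have hRc : Multiset.card Ri + Multiset.card Ro = Multiset.card R := by
    rw [← Multiset.card_add, hRR]
  have hRi' : ∀ R' ≤ Ri, Multiset.card R' + 1 ≤ (subSums R').ncard := fun R' h =>
    hR R' (h.trans (Multiset.filter_le _ _))
  rcases filled_or_concentrated L hLodd (Fi.map (· - c)) Ri (by
      intro x hx
      obtain ⟨y, hy, rfl⟩ := Multiset.mem_map.1 hx
      exact (Multiset.mem_filter.1 hy).2) (fun x hx => (Multiset.mem_filter.1 hx).2) hRi' (by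
      rw [Multiset.card_map]; omega) with ⟨N₀, hN₀, hfill₀⟩ | ⟨L₁, hL₁, c₁, -, hc₁⟩
  · obtain ⟨N₁, hN₁, hfill, hcard⟩ := exists_thin (fun p : α × α => p.1 - p.2) Ri N₀
    replace hfill : subSums (Ri + diffs N₁) = L := hfill.trans hfill₀
    replace hcard : (subSums Ri).ncard + Multiset.card N₁ ≤ Nat.card L := by
      rw [← ncard_coe_addSubgroup, ← hfill₀]; exact hcard
    have hgrow := hRi' Ri le_rfl
    refine ⟨L, c, isRobust_of_pairs (N := N₁.map fun p => (p.1 + c, p.2 + c)) hF ?_ ?_ ?_⟩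
    · have h1 : legs N₁ ≤ Fi.map (· - c) := by
        obtain ⟨N', rfl⟩ := Multiset.le_iff_exists_add.1 hN₁
        rw [legs_add] at hN₀
        exact (Multiset.le_add_right _ _).trans hN₀
      have h2 := Multiset.map_le_map (f := (· + c)) h1
      rw [Multiset.map_map] at h2
      simpa [legs, Function.comp_def] using h2
    · rw [← hfill]
      congr 2
      simp [diffs]
    · rw [Multiset.card_map]
      change Multiset.card Fo + _ ≤ Multiset.card Fi
      omega
  · refine absurd hL₁ (hmin L₁ ⟨c + c₁, ?_⟩)
    have h1 : Multiset.card (F.filter fun x => x - (c + c₁) ∉ L₁) ≤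
        Multiset.card ((Fi.map (· - c)).filter fun x => x - c₁ ∉ L₁) + Multiset.card Fo := by
      rw [← hFF, Multiset.filter_add, Multiset.card_add, Multiset.filter_map, Multiset.card_map]
      simp only [Function.comp_def, sub_sub]
      exact Nat.add_le_add_left (Multiset.card_le_card (Multiset.filter_le _ _)) _
    have h2 : Multiset.card (R.filter fun x => x ∉ L₁) ≤
        Multiset.card (Ri.filter fun x => x ∉ L₁) + Multiset.card Ro := by
      conv_lhs => rw [← hRR]
      rw [Multiset.filter_add, Multiset.card_add]
      exact Nat.add_le_add_left (Multiset.card_le_card (Multiset.filter_le _ _)) _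
    omega

theorem exists_isRobust_few_exceptions (hodd : Odd (Nat.card α)) {F R : Multiset α} {k : ℕ}
    (hF : Multiset.card F = 2 * k)
    (hR : ∀ R' ≤ R, Multiset.card R' + 1 ≤ (subSums R').ncard)
    (hsize : 2 * Nat.card α ≤ Multiset.card F + Multiset.card R + 1)
    {τ : α} (hτ : ∀ P ≤ F, Multiset.card P = k → ∀ B ≤ R, P.sum + B.sum ≠ τ) :
    ∃ L c, IsRobust F R k L c ∧
      Multiset.card ((F.map (· - c) + R).filter fun x => x ∉ L) + 2 ≤ L.index := by
  obtain ⟨L₀, hL₀⟩ := exists_isRobust hodd hF hR hsize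
  obtain ⟨L, ⟨c, hc⟩, hmax⟩ := WellFounded.has_min (wellFounded_gt (α := AddSubgroup α))
    {L | ∃ c, IsRobust F R k L c} ⟨L₀, hL₀⟩
  refine ⟨L, c, hc, ?_⟩
  set J := (F.map (· - c) + R).filter fun x => x ∉ L with hJ
  have hJD : J ≤ F.map (· - c) + R := Multiset.filter_le _ _
  have hgrow : Multiset.card J + 1 ≤
      ((QuotientAddGroup.mk : α → α ⧸ L) '' subSums J).ncard := by
    by_contra hlt
    obtain ⟨I, hI, L', hL', hIL, hfill⟩ := exists_filled_extension id L J
      (fun i hi => (Multiset.mem_filter.1 hi).2) (by rw [Multiset.map_id]; omega)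
    exact hmax L' ⟨c, hc.extend (hI.trans hJD) hIL (by simpa using hfill)⟩ hL'
  have hlt : ((QuotientAddGroup.mk : α → α ⧸ L) '' subSums J).ncard < Nat.card (α ⧸ L) := by
    rw [← Set.ncard_univ]
    refine Set.ncard_lt_ncard (Set.ssubset_univ_iff.2 fun huniv => ?_) (Set.toFinite _)
    have : (QuotientAddGroup.mk (τ - k • c) : α ⧸ L) ∈
        (QuotientAddGroup.mk : α → α ⧸ L) '' subSums J := by rw [huniv]; trivial
    obtain ⟨_, ⟨t, ht, rfl⟩, hx⟩ := this
    obtain ⟨P, hP, hPk, B, hB, hsum⟩ := hc t (ht.trans hJD) _ (QuotientAddGroup.eq.1 hx)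
    exact hτ P hP hPk B hB (hsum.trans (by abel))
  rw [AddSubgroup.index]
  omega

end Robust
end DihedralOmega

namespace DihedralOmega
open scoped Classical
open ProductOne DihedralGroup

lemma isProductOne_zero {G : Type*} [Group G] : IsProductOne (0 : Multiset G) := ⟨[], rfl, rfl⟩

lemma _root_.ProductOne.IsProductOne.add {G : Type*} [Group G] {A B : Multiset G}
    (hA : IsProductOne A) (hB : IsProductOne B) : IsProductOne (A + B) := by
  obtain ⟨l, rfl, hl⟩ := hA
  obtain ⟨m, rfl, hm⟩ := hB
  exact ⟨l ++ m, rfl, by simp [hl, hm]⟩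

section Arrangement

variable {n : ℕ}

/-- The exponent of a rotation. -/
def rotExp : DihedralGroup n → Option (ZMod n)
  | r i => some i
  | sr _ => none

/-- The exponent of a reflection. -/
def reflExp : DihedralGroup n → Option (ZMod n)
  | r _ => none
  | sr i => some i

/-- The exponents of the rotations in `S`. -/
def rot (S : Multiset (DihedralGroup n)) : Multiset (ZMod n) := S.filterMap rotExp

/-- The exponents of the reflections in `S`. -/
def refl (S : Multiset (DihedralGroup n)) : Multiset (ZMod n) := S.filterMap reflExp

@[simp] lemma rot_zero : rot (0 : Multiset (DihedralGroup n)) = 0 := rfl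
@[simp] lemma refl_zero : refl (0 : Multiset (DihedralGroup n)) = 0 := rfl

@[simp] lemma rot_cons_r (i : ZMod n) (S) : rot (r i ::ₘ S) = i ::ₘ rot S :=
  Multiset.filterMap_cons_some _ _ _ rfl
@[simp] lemma rot_cons_sr (i : ZMod n) (S) : rot (sr i ::ₘ S) = rot S :=
  Multiset.filterMap_cons_none _ _ rfl
@[simp] lemma refl_cons_r (i : ZMod n) (S) : refl (r i ::ₘ S) = refl S :=
  Multiset.filterMap_cons_none _ _ rfl
@[simp] lemma refl_cons_sr (i : ZMod n) (S) : refl (sr i ::ₘ S) = i ::ₘ refl S :=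
  Multiset.filterMap_cons_some _ _ _ rfl

/-- The sequence with given rotation and reflection exponents. -/
def assemble (R F : Multiset (ZMod n)) : Multiset (DihedralGroup n) := R.map r + F.map sr

@[simp] lemma rot_add (S T : Multiset (DihedralGroup n)) : rot (S + T) = rot S + rot T :=
  Multiset.filterMap_add _ _ _

@[simp] lemma refl_add (S T : Multiset (DihedralGroup n)) : refl (S + T) = refl S + refl T :=
  Multiset.filterMap_add _ _ _

@[simp] lemma assemble_rot_refl (S : Multiset (DihedralGroup n)) :
    assemble (rot S) (refl S) = S := by
  induction S using Multiset.induction_on with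
  | empty => rfl
  | cons g S ih => rcases g with i | i <;> simpa [assemble] using ih

@[simp] lemma rot_assemble (R F : Multiset (ZMod n)) : rot (assemble R F) = R := by
  have h1 : rot (R.map r) = R := by
    induction R using Multiset.induction_on with
    | empty => rfl
    | cons g S ih => simp [ih]
  have h2 : rot (F.map sr) = 0 := by
    induction F using Multiset.induction_on with
    | empty => rfl
    | cons g S ih => simp [ih]
  simp [assemble, h1, h2]

@[simp] lemma refl_assemble (R F : Multiset (ZMod n)) : refl (assemble R F) = F := by
  have h1 : refl (R.map r) = 0 := by
    induction R using Multiset.induction_on with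
    | empty => rfl
    | cons g S ih => simp [ih]
  have h2 : refl (F.map sr) = F := by
    induction F using Multiset.induction_on with
    | empty => rfl
    | cons g S ih => simp [ih]
  simp [assemble, h1, h2]

lemma assemble_add (R R' F F' : Multiset (ZMod n)) :
    assemble (R + R') (F + F') = assemble R F + assemble R' F' := by
  simp only [assemble, Multiset.map_add]; abel

lemma card_rot_add_card_refl (S : Multiset (DihedralGroup n)) :
    Multiset.card (rot S) + Multiset.card (refl S) = Multiset.card S := by
  conv_rhs => rw [← assemble_rot_refl S]
  simp [assemble]

lemma mem_rot {S : Multiset (DihedralGroup n)} {i : ZMod n} : i ∈ rot S ↔ r i ∈ S := by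
  conv_rhs => rw [← assemble_rot_refl S]
  simp [assemble]

lemma mem_refl {S : Multiset (DihedralGroup n)} {i : ZMod n} : i ∈ refl S ↔ sr i ∈ S := by
  conv_rhs => rw [← assemble_rot_refl S]
  simp [assemble]

lemma exists_split_of_list (l : List (DihedralGroup n)) :
    ∃ P Q R₁ R₂ : Multiset (ZMod n), rot (l : Multiset (DihedralGroup n)) = R₁ + R₂ ∧
      refl (l : Multiset (DihedralGroup n)) = P + Q ∧
      (refl (l : Multiset (DihedralGroup n)) = 0 → R₂ = 0) ∧
      ((l.prod = r (P.sum + R₁.sum - Q.sum - R₂.sum) ∧ Multiset.card P = Multiset.card Q) ∨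
      (l.prod = sr (P.sum + R₁.sum - Q.sum - R₂.sum) ∧
        Multiset.card P = Multiset.card Q + 1)) := by
  induction l with
  | nil => exact ⟨0, 0, 0, 0, by simp, by simp, by simp, Or.inl ⟨by simp, rfl⟩⟩
  | cons g l ih =>
    obtain ⟨P, Q, R₁, R₂, hR, hF, h0, ⟨hp, hc⟩ | ⟨hp, hc⟩⟩ := ih
    · rcases g with i | i
      · refine ⟨P, Q, i ::ₘ R₁, R₂, ?_, ?_, ?_, Or.inl ⟨?_, hc⟩⟩
        · rw [← Multiset.cons_coe, rot_cons_r, hR, Multiset.cons_add]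
        · rw [← Multiset.cons_coe, refl_cons_r, hF]
        · rwa [← Multiset.cons_coe, refl_cons_r]
        · rw [List.prod_cons, hp, r_mul_r, Multiset.sum_cons]; congr 1; abel
      · refine ⟨i ::ₘ P, Q, R₁, R₂, ?_, ?_, ?_, Or.inr ⟨?_, by simp [hc]⟩⟩
        · rw [← Multiset.cons_coe, rot_cons_sr, hR]
        · rw [← Multiset.cons_coe, refl_cons_sr, hF, Multiset.cons_add]
        · intro h; rw [← Multiset.cons_coe, refl_cons_sr] at h
          exact absurd h (Multiset.cons_ne_zero)
        · rw [List.prod_cons, hp, sr_mul_r, Multiset.sum_cons]; congr 1; abel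
    · rcases g with i | i
      · refine ⟨P, Q, R₁, i ::ₘ R₂, ?_, ?_, ?_, Or.inr ⟨?_, hc⟩⟩
        · rw [← Multiset.cons_coe, rot_cons_r, hR, Multiset.add_cons]
        · rw [← Multiset.cons_coe, refl_cons_r, hF]
        · intro h
          rw [← Multiset.cons_coe, refl_cons_r, hF] at h
          have := congrArg Multiset.card h
          simp [hc] at this
        · rw [List.prod_cons, hp, r_mul_sr, Multiset.sum_cons]; congr 1; abel
      · refine ⟨P, i ::ₘ Q, R₁, R₂, ?_, ?_, ?_, Or.inl ⟨?_, by simp [hc]⟩⟩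
        · rw [← Multiset.cons_coe, rot_cons_sr, hR]
        · rw [← Multiset.cons_coe, refl_cons_sr, hF, Multiset.add_cons]
        · intro h; rw [← Multiset.cons_coe, refl_cons_sr] at h
          exact absurd h (Multiset.cons_ne_zero)
        · rw [List.prod_cons, hp, sr_mul_sr, Multiset.sum_cons]; congr 1; abel

lemma _root_.ProductOne.IsProductOne.exists_split {S : Multiset (DihedralGroup n)}
    (h : IsProductOne S) :
    ∃ P Q R₁ R₂, rot S = R₁ + R₂ ∧ refl S = P + Q ∧ (refl S = 0 → R₂ = 0) ∧
      Multiset.card P = Multiset.card Q ∧ P.sum + R₁.sum = Q.sum + R₂.sum := by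
  obtain ⟨l, rfl, hl⟩ := h
  obtain ⟨P, Q, R₁, R₂, hR, hF, h0, ⟨hp, hc⟩ | ⟨hp, hc⟩⟩ := exists_split_of_list l
  · refine ⟨P, Q, R₁, R₂, hR, hF, h0, hc, ?_⟩
    rw [hp, one_def] at hl
    have := r.inj hl
    rwa [sub_sub, sub_eq_zero] at this
  · rw [hp, one_def] at hl
    cases hl

lemma exists_alternating (P Q : Multiset (ZMod n)) (h : Multiset.card P = Multiset.card Q) :
    ∃ l : List (DihedralGroup n), (l : Multiset (DihedralGroup n)) = assemble 0 (P + Q) ∧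
      l.prod = r (P.sum - Q.sum) := by
  induction P using Multiset.induction_on generalizing Q with
  | empty =>
    obtain rfl : Q = 0 := Multiset.card_eq_zero.1 (by simpa using h.symm)
    exact ⟨[], by simp [assemble], by simp⟩
  | cons p P ih =>
    obtain ⟨q, Q, rfl⟩ : ∃ q Q', Q = q ::ₘ Q' := by
      obtain ⟨q, hq⟩ := Multiset.card_pos_iff_exists_mem.1 (by rw [← h]; simp : 0 < Multiset.card Q)
      exact ⟨q, _, (Multiset.cons_erase hq).symm⟩
    obtain ⟨l, hl, hp⟩ := ih Q (by simpa using h)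
    refine ⟨sr q :: sr p :: l, ?_, ?_⟩
    · rw [← Multiset.cons_coe, ← Multiset.cons_coe, hl]
      simp [assemble, Multiset.cons_swap]
    · rw [List.prod_cons, List.prod_cons, hp, sr_mul_r, sr_mul_sr, Multiset.sum_cons,
        Multiset.sum_cons]
      congr 1; abel

lemma exists_rotation_list (R : Multiset (ZMod n)) :
    ∃ l : List (DihedralGroup n), (l : Multiset (DihedralGroup n)) = assemble R 0 ∧
      l.prod = r R.sum := by
  induction R using Multiset.induction_on with
  | empty => exact ⟨[], by simp [assemble], by simp⟩
  | cons p P ih =>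
    obtain ⟨l, hl, hp⟩ := ih
    refine ⟨r p :: l, ?_, ?_⟩
    · rw [← Multiset.cons_coe, hl]; simp [assemble]
    · rw [List.prod_cons, hp, r_mul_r, Multiset.sum_cons]

lemma isProductOne_assemble {P Q R₁ R₂ : Multiset (ZMod n)} (h0 : P + Q = 0 → R₂ = 0)
    (hc : Multiset.card P = Multiset.card Q) (hs : P.sum + R₁.sum = Q.sum + R₂.sum) :
    IsProductOne (assemble (R₁ + R₂) (P + Q)) := by
  obtain ⟨l₁, h₁, p₁⟩ := exists_rotation_list R₁
  rcases P.empty_or_exists_mem with rfl | ⟨p, hp⟩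
  · obtain rfl : Q = 0 := Multiset.card_eq_zero.1 (by simpa using hc.symm)
    obtain rfl := h0 rfl
    exact ⟨l₁, by simpa using h₁, by rw [p₁, one_def]; exact congrArg r (by simpa using hs)⟩
  · obtain ⟨P, rfl⟩ : ∃ P', P = p ::ₘ P' := ⟨_, (Multiset.cons_erase hp).symm⟩
    obtain ⟨q, Q, rfl⟩ : ∃ q Q', Q = q ::ₘ Q' := by
      obtain ⟨q, hq⟩ := Multiset.card_pos_iff_exists_mem.1
        (by rw [← hc]; simp : 0 < Multiset.card Q)
      exact ⟨q, _, (Multiset.cons_erase hq).symm⟩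
    obtain ⟨l₂, h₂, p₂⟩ := exists_rotation_list R₂
    obtain ⟨l₃, h₃, p₃⟩ := exists_alternating P Q (by simpa using hc)
    refine ⟨l₁ ++ (sr q :: (l₂ ++ (sr p :: l₃))), ?_, ?_⟩
    · rw [← Multiset.coe_add, ← Multiset.cons_coe, ← Multiset.coe_add, ← Multiset.cons_coe,
        h₁, h₂, h₃]
      simp only [assemble, Multiset.map_add, Multiset.map_zero,
        ← Multiset.singleton_add, Multiset.map_singleton]
      abel
    · rw [List.prod_append, List.prod_cons, List.prod_append, List.prod_cons, p₁, p₂, p₃,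
        sr_mul_r, r_mul_sr, sr_mul_sr, r_mul_r, one_def]
      simp only [Multiset.sum_cons] at hs
      congr 1
      rw [← sub_eq_zero] at hs
      rw [← hs]; abel

lemma _root_.ProductOne.IsProductOne.even_card_refl {S : Multiset (DihedralGroup n)}
    (h : IsProductOne S) :
    Even (Multiset.card (refl S)) := by
  obtain ⟨P, Q, R₁, R₂, -, hF, -, hc, -⟩ := h.exists_split
  exact ⟨Multiset.card Q, by rw [hF, Multiset.card_add, hc]⟩

lemma isProductOne_of_half {S : Multiset (DihedralGroup n)} (hF : refl S ≠ 0) {k : ℕ}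
    (hk : Multiset.card (refl S) = 2 * k) {P B : Multiset (ZMod n)} (hP : P ≤ refl S)
    (hPk : Multiset.card P = k) (hB : B ≤ rot S)
    (hs : 2 • (P.sum + B.sum) = (refl S).sum + (rot S).sum) : IsProductOne S := by
  obtain ⟨Q, hQ⟩ := Multiset.le_iff_exists_add.1 hP
  obtain ⟨B', hB'⟩ := Multiset.le_iff_exists_add.1 hB
  rw [← assemble_rot_refl S, hQ, hB']
  refine isProductOne_assemble (fun h => absurd (hQ.trans h) hF) ?_ ?_
  · rw [hQ, Multiset.card_add] at hk; omega
  · rw [hQ, hB', Multiset.sum_add, Multiset.sum_add, two_nsmul, ← sub_eq_zero] at hs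
    rw [← sub_eq_zero, ← hs]; abel

lemma _root_.ProductOne.IsProductOne.exists_half {S : Multiset (DihedralGroup n)}
    (h : IsProductOne S) {k : ℕ}
    (hk : Multiset.card (refl S) = 2 * k) :
    ∃ P ≤ refl S, Multiset.card P = k ∧ ∃ B ≤ rot S,
      2 • (P.sum + B.sum) = (refl S).sum + (rot S).sum := by
  obtain ⟨P, Q, R₁, R₂, hR, hF, -, hc, hs⟩ := h.exists_split
  refine ⟨P, hF ▸ Multiset.le_add_right _ _, ?_, R₁, hR ▸ Multiset.le_add_right _ _, ?_⟩
  · rw [hF, Multiset.card_add] at hk; omega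
  · rw [hF, hR, Multiset.sum_add, Multiset.sum_add, two_nsmul]
    nth_rewrite 2 [hs]
    abel

end Arrangement
end DihedralOmega

namespace DihedralOmega
open scoped Classical
open ProductOne DihedralGroup

section Halving

variable {α : Type*} [AddCommGroup α]

lemma exists_two_nsmul_eq (hodd : Odd (Nat.card α)) {H : AddSubgroup α} {x : α} (hx : x ∈ H) :
    ∃ y ∈ H, 2 • y = x := by
  obtain ⟨m, hm⟩ := hodd
  refine ⟨(m + 1) • x, H.nsmul_mem hx _, ?_⟩
  rw [← mul_nsmul', show 2 * (m + 1) = Nat.card α + 1 by omega, succ_nsmul, card_nsmul_eq_zero',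
    zero_add]

lemma two_nsmul_injective (hodd : Odd (Nat.card α)) {x y : α} (h : 2 • x = 2 • y) : x = y := by
  obtain ⟨m, hm⟩ := hodd
  have key : ∀ z : α, (m + 1) • 2 • z = z := fun z => by
    rw [← mul_nsmul', show (m + 1) * 2 = Nat.card α + 1 by omega, succ_nsmul,
      card_nsmul_eq_zero', zero_add]
  rw [← key x, h, key]

end Halving

variable {n : ℕ}

/-- The subgroup of rotations with exponent in `H`, together with, if `b` holds, the reflections
with exponent in `c + H`. -/
def dihedralSubgroup (H : AddSubgroup (ZMod n)) (c : ZMod n) (b : Prop) :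
    Subgroup (DihedralGroup n) where
  carrier := {g | (∃ i ∈ H, g = r i) ∨ (b ∧ ∃ i, i - c ∈ H ∧ g = sr i)}
  one_mem' := Or.inl ⟨0, H.zero_mem, rfl⟩
  mul_mem' := by
    rintro _ _ (⟨i, hi, rfl⟩ | ⟨hb, i, hi, rfl⟩) (⟨j, hj, rfl⟩ | ⟨hb', j, hj, rfl⟩)
    · exact Or.inl ⟨i + j, H.add_mem hi hj, rfl⟩
    · exact Or.inr ⟨hb', j - i, by rw [sub_right_comm]; exact H.sub_mem hj hi, rfl⟩
    · exact Or.inr ⟨hb, i + j, by rw [add_sub_right_comm]; exact H.add_mem hi hj, rfl⟩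
    · exact Or.inl ⟨j - i, by rw [← sub_sub_sub_cancel_right j i c]; exact H.sub_mem hj hi, rfl⟩
  inv_mem' := by
    rintro _ (⟨i, hi, rfl⟩ | ⟨hb, i, hi, rfl⟩)
    · exact Or.inl ⟨-i, H.neg_mem hi, rfl⟩
    · exact Or.inr ⟨hb, i, hi, rfl⟩

lemma r_mem_dihedralSubgroup {H : AddSubgroup (ZMod n)} {c : ZMod n} {b : Prop} {i : ZMod n} :
    r i ∈ dihedralSubgroup H c b ↔ i ∈ H := by
  constructor
  · rintro (⟨j, hj, h⟩ | ⟨-, j, -, h⟩)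
    · rwa [r.inj h]
    · cases h
  · exact fun h => Or.inl ⟨i, h, rfl⟩

lemma sr_mem_dihedralSubgroup {H : AddSubgroup (ZMod n)} {c : ZMod n} {b : Prop} {i : ZMod n} :
    sr i ∈ dihedralSubgroup H c b ↔ b ∧ i - c ∈ H := by
  constructor
  · rintro (⟨j, hj, h⟩ | ⟨hb, j, hj, h⟩)
    · cases h
    · exact ⟨hb, by rwa [sr.inj h]⟩
  · exact fun h => Or.inr ⟨h.1, i, h.2, rfl⟩

lemma natCard_dihedral : Nat.card (DihedralGroup n) = 2 * n := DihedralGroup.nat_card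

lemma ncard_image_sub [NeZero n] (H : AddSubgroup (ZMod n)) (c : ZMod n) :
    {i | i - c ∈ H}.ncard = Nat.card H := by
  rw [← ncard_coe_addSubgroup, ← Set.ncard_image_of_injective (H : Set (ZMod n))
    (add_left_injective c)]
  congr 1
  ext i
  simp [sub_eq_add_neg]

lemma index_dihedralSubgroup_false [NeZero n] (H : AddSubgroup (ZMod n)) (c : ZMod n) :
    2 * H.index ≤ (dihedralSubgroup H c False).index := by
  have h1 := (dihedralSubgroup H c False).card_mul_index
  have h2 := H.card_mul_index
  rw [natCard_dihedral] at h1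
  rw [Nat.card_zmod] at h2
  have h3 : Nat.card (dihedralSubgroup H c False) ≤ Nat.card H := by
    rw [← ncard_coe_addSubgroup, ← Set.ncard_image_of_injective (H : Set (ZMod n))
      (fun i j h => r.inj h : Function.Injective (r : ZMod n → _)), ← SetLike.coe_sort_coe,
      Nat.card_coe_set_eq]
    refine Set.ncard_le_ncard ?_ (Set.toFinite _)
    rintro _ (⟨i, hi, rfl⟩ | ⟨hb, -⟩)
    · exact ⟨i, hi, rfl⟩
    · exact hb.elim
  have h4 : 0 < Nat.card H := Nat.card_pos
  by_contra hlt
  have := Nat.mul_le_mul_right (dihedralSubgroup H c False).index h3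
  have h5 : Nat.card H * (dihedralSubgroup H c False).index < Nat.card H * (2 * H.index) :=
    Nat.mul_lt_mul_of_pos_left (not_le.1 hlt) h4
  have h6 : Nat.card H * (2 * H.index) = 2 * n := by rw [mul_left_comm, h2]
  omega

lemma index_dihedralSubgroup [NeZero n] (H : AddSubgroup (ZMod n)) (c : ZMod n) :
    H.index ≤ (dihedralSubgroup H c True).index := by
  have h1 := (dihedralSubgroup H c True).card_mul_index
  have h2 := H.card_mul_index
  rw [natCard_dihedral] at h1
  rw [Nat.card_zmod] at h2
  have h3 : Nat.card (dihedralSubgroup H c True) ≤ 2 * Nat.card H := by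
    have e1 : (r '' (H : Set (ZMod n))).ncard = Nat.card H := by
      rw [Set.ncard_image_of_injective _
        (fun i j h => r.inj h : Function.Injective (r : ZMod n → _)), ncard_coe_addSubgroup]
    have e2 : (sr '' {i | i - c ∈ H}).ncard = Nat.card H := by
      rw [Set.ncard_image_of_injective _
        (fun i j h => sr.inj h : Function.Injective (sr : ZMod n → _)), ncard_image_sub]
    have e3 := Set.ncard_union_le (r '' (H : Set (ZMod n))) (sr '' {i | i - c ∈ H})
    rw [e1, e2] at e3
    rw [two_mul, ← SetLike.coe_sort_coe, Nat.card_coe_set_eq]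
    refine (Set.ncard_le_ncard ?_ (Set.toFinite _)).trans e3
    rintro _ (⟨i, hi, rfl⟩ | ⟨-, i, hi, rfl⟩)
    · exact Or.inl ⟨i, hi, rfl⟩
    · exact Or.inr ⟨i, hi, rfl⟩
  have h4 : 0 < Nat.card H := Nat.card_pos
  by_contra hlt
  have := Nat.mul_le_mul_right (dihedralSubgroup H c True).index h3
  have h5 : Nat.card H * (dihedralSubgroup H c True).index < Nat.card H * H.index :=
    Nat.mul_lt_mul_of_pos_left (not_le.1 hlt) h4
  rw [mul_assoc] at this
  omega

lemma card_filter_eq (S : Multiset (DihedralGroup n)) (p : DihedralGroup n → Prop)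
    [DecidablePred p] : Multiset.card (S.filter p) =
      Multiset.card ((rot S).filter fun i => p (r i)) +
      Multiset.card ((refl S).filter fun i => p (sr i)) := by
  conv_lhs => rw [← assemble_rot_refl S]
  rw [assemble, Multiset.filter_add, Multiset.card_add, Multiset.filter_map, Multiset.filter_map,
    Multiset.card_map, Multiset.card_map]
  rfl

lemma isProductOne_iff_of_refl_eq_zero {S : Multiset (DihedralGroup n)} (h : refl S = 0) :
    IsProductOne S ↔ (rot S).sum = 0 := by
  constructor
  · intro hS
    obtain ⟨P, Q, R₁, R₂, hR, hF, h0, -, hs⟩ := hS.exists_split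
    rw [h] at hF
    obtain ⟨rfl, rfl⟩ := add_eq_zero.1 hF.symm
    rw [hR, h0 h]
    simpa [h0 h] using hs
  · intro hs
    rw [← assemble_rot_refl S, h]
    simpa using isProductOne_assemble (P := 0) (Q := 0) (R₁ := rot S) (R₂ := 0) (by simp) rfl
      (by simpa using hs)

lemma refl_eq_zero_of_forall_mem {A : Multiset (DihedralGroup n)} {H : AddSubgroup (ZMod n)}
    {c : ZMod n} (h : ∀ g ∈ A, g ∈ dihedralSubgroup H c False) : refl A = 0 :=
  Multiset.eq_zero_of_forall_notMem fun _ hi =>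
    (sr_mem_dihedralSubgroup.1 (h _ (mem_refl.1 hi))).1

lemma sum_sub_card_nsmul_mem {α : Type*} [AddCommGroup α] {D : Multiset α} {L : AddSubgroup α}
    {c : α} (h : ∀ d ∈ D, d - c ∈ L) : D.sum - Multiset.card D • c ∈ L := by
  rw [← sum_map_sub_const]
  exact sum_mem_of_forall fun x hx => by
    obtain ⟨y, hy, rfl⟩ := Multiset.mem_map.1 hx
    exact h y hy

theorem exists_subgroup_of_not_isProductOne [NeZero n] (hodd : Odd n)
    {C A : Multiset (DihedralGroup n)} (hA : IsProductOne A) (hCA : IsProductOne (C + A))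
    (hC : ¬ IsProductOne C) :
    ∃ K : Subgroup (DihedralGroup n),
      Multiset.card (C.filter fun g => g ∉ K) + 2 ≤ K.index ∧ ∃ g ∈ A, g ∉ K := by
  have hoddα : Odd (Nat.card (ZMod n)) := by rwa [Nat.card_zmod]
  by_cases hF : refl C = 0
  · refine ⟨dihedralSubgroup ⊤ 0 False, ?_, ?_⟩
    · have := index_dihedralSubgroup_false (n := n) ⊤ 0
      rw [card_filter_eq, hF]
      simp only [r_mem_dihedralSubgroup]
      simpa using this
    · by_contra! hcon
      have hA0 := refl_eq_zero_of_forall_mem hcon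
      rw [isProductOne_iff_of_refl_eq_zero hA0] at hA
      rw [isProductOne_iff_of_refl_eq_zero (by simp [hF, hA0]), rot_add, Multiset.sum_add, hA,
        add_zero] at hCA
      exact hC ((isProductOne_iff_of_refl_eq_zero hF).2 hCA)
  obtain ⟨k, hk⟩ : ∃ k, Multiset.card (refl C) = 2 * k := by
    have h1 := hCA.even_card_refl
    rw [refl_add, Multiset.card_add, Nat.even_add] at h1
    obtain ⟨k, hk⟩ := h1.2 hA.even_card_refl
    exact ⟨k, by omega⟩
  obtain ⟨a, ha⟩ : ∃ a, Multiset.card (refl A) = 2 * a := by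
    obtain ⟨a, ha⟩ := hA.even_card_refl
    exact ⟨a, by omega⟩
  set H₀ := periods (subSums (rot C)) with hH₀
  have hlift : ∀ P ≤ refl C, Multiset.card P = k → ∀ B ≤ rot C, ∀ e ∈ H₀,
      2 • (P.sum + B.sum + e) ≠ (refl C).sum + (rot C).sum := by
    intro P hP hPk B hB e he heq
    obtain ⟨B', hB', hs⟩ := mem_periods.1 he _ ⟨B, hB, rfl⟩
    refine hC (isProductOne_of_half hF hk hP hPk hB' ?_)
    rw [← heq, hs]
    congr 1; abel
  obtain ⟨P, hP, hPk, B, hB, hs⟩ := hCA.exists_half (k := k + a)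
    (by rw [refl_add, Multiset.card_add]; omega)
  rw [refl_add] at hP
  rw [rot_add] at hB
  obtain ⟨P₁, P₂, hP₁, hP₂, rfl⟩ := exists_add_of_le_add hP
  obtain ⟨B₁, B₂, hB₁, hB₂, rfl⟩ := exists_add_of_le_add hB
  rw [Multiset.card_add] at hPk
  simp only [refl_add, rot_add, Multiset.sum_add] at hs
  set R' := (rot C).filter fun i => i ∉ H₀ with hR'
  by_cases hsz : Multiset.card (refl C) + Multiset.card R' + 2 ≤ 2 * H₀.index
  · refine ⟨dihedralSubgroup H₀ 0 False, ?_, ?_⟩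
    · refine le_trans ?_ (hsz.trans (index_dihedralSubgroup_false _ _))
      rw [card_filter_eq, add_comm (Multiset.card (refl C))]
      refine Nat.add_le_add_right (add_le_add (le_of_eq ?_)
        (Multiset.card_le_card (Multiset.filter_le _ _))) 2
      simp only [r_mem_dihedralSubgroup, hR']
    · by_contra! hcon
      have hA0 := refl_eq_zero_of_forall_mem hcon
      have hAH : ∀ i ∈ rot A, i ∈ H₀ := fun i hi =>
        r_mem_dihedralSubgroup.1 (hcon _ (mem_rot.1 hi))
      rw [hA0] at hP₂ ha
      obtain rfl := Multiset.le_zero.1 hP₂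
      have ha0 : a = 0 := by simpa using ha
      obtain ⟨y, hy, hy2⟩ := exists_two_nsmul_eq hoddα (sum_mem_of_forall hAH)
      refine hlift P₁ hP₁ (by simpa [ha0] using hPk) B₁ hB₁ (B₂.sum - y)
        (H₀.sub_mem (sum_mem_of_forall fun i hi => hAH i (Multiset.mem_of_le hB₂ hi)) hy) ?_
      rw [hA0] at hs
      rw [← hy2] at hs
      simp only [Multiset.sum_zero, add_zero] at hs
      have e1 : 2 • (P₁.sum + B₁.sum + (B₂.sum - y)) =
        2 • (P₁.sum + (B₁.sum + B₂.sum)) - 2 • y := by simp only [two_nsmul]; abel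
      rw [e1, hs]; abel
  · have hoddq : Odd (Nat.card (ZMod n ⧸ H₀)) := Odd.of_dvd_nat hoddα
      (AddSubgroup.card_quotient_dvd_card H₀)
    set q := QuotientAddGroup.mk' H₀ with hq
    obtain ⟨τ₀, -, hτ₀⟩ := exists_two_nsmul_eq hoddα
      (AddSubgroup.mem_top ((refl C).sum + (rot C).sum))
    have hτ : ∀ P ≤ (refl C).map q, Multiset.card P = k → ∀ B ≤ R'.map q,
        P.sum + B.sum ≠ q τ₀ := by
      intro P' hP' hPk B' hB' hsum
      obtain ⟨P, hP, rfl⟩ := exists_le_of_le_map hP'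
      obtain ⟨B, hB, rfl⟩ := exists_le_of_le_map hB'
      rw [Multiset.card_map] at hPk
      rw [← map_multiset_sum, ← map_multiset_sum, ← map_add] at hsum
      refine hlift P hP hPk B (hB.trans (Multiset.filter_le _ _)) (-(P.sum + B.sum) + τ₀)
        (QuotientAddGroup.eq.1 hsum) ?_
      rw [add_neg_cancel_left, hτ₀]
    obtain ⟨L, c', hrob, hexc⟩ := exists_isRobust_few_exceptions (F := (refl C).map q)
      (R := R'.map q) (k := k) (τ := q τ₀) hoddq (by rw [Multiset.card_map, hk])
      (by
        intro E hE
        obtain ⟨E', hE', rfl⟩ := exists_le_of_le_map hE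
        rw [subSums_map, Multiset.card_map]
        exact card_succ_le_ncard_image_subSums (rot C) (hE'.trans (Multiset.filter_le _ _))
          fun d hd => (Multiset.mem_filter.1 (Multiset.mem_of_le hE' hd)).2)
      (by
        rw [Multiset.card_map, Multiset.card_map]
        change 2 * H₀.index ≤ _
        omega) hτ
    obtain ⟨c, rfl⟩ := QuotientAddGroup.mk'_surjective H₀ c'
    change IsRobust _ _ _ _ (q c) at hrob
    change Multiset.card (Multiset.filter _ (Multiset.map (· - q c) _ + _)) + 2 ≤ _ at hexc
    have hq0 : ∀ x ∈ H₀, q x = 0 := fun x hx => (QuotientAddGroup.eq_zero_iff x).2 hx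
    have hH₀L : H₀ ≤ L.comap q := fun x hx => by
      rw [AddSubgroup.mem_comap, hq0 x hx]
      exact L.zero_mem
    refine ⟨dihedralSubgroup (L.comap q) c True, ?_, ?_⟩
    · refine le_trans ?_ (index_dihedralSubgroup _ _)
      rw [AddSubgroup.index_comap_of_surjective _ (QuotientAddGroup.mk'_surjective H₀)]
      refine le_trans (Nat.add_le_add_right ?_ 2) hexc
      rw [card_filter_eq]
      simp only [r_mem_dihedralSubgroup, sr_mem_dihedralSubgroup, true_and]
      rw [Multiset.filter_add, Multiset.card_add, Multiset.map_map, Multiset.filter_map,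
        Multiset.filter_map, Multiset.card_map, Multiset.card_map, add_comm]
      refine add_le_add (le_of_eq ?_) (Multiset.card_le_card ?_)
      · simp only [Function.comp_def, AddSubgroup.mem_comap, map_sub]
      · rw [hR', Multiset.filter_filter]
        refine Multiset.monotone_filter_right _ fun i hi => ⟨hi, fun h => hi (hH₀L h)⟩
    · by_contra! hcon
      have hAr : ∀ i ∈ rot A, q i ∈ L := fun i hi =>
        r_mem_dihedralSubgroup.1 (hcon _ (mem_rot.1 hi))
      have hAs : ∀ i ∈ refl A, i - c ∈ L.comap q := fun i hi =>
        (sr_mem_dihedralSubgroup.1 (hcon _ (mem_refl.1 hi))).2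
      have hx : τ₀ - k • c - P₁.sum + Multiset.card P₁ • c - B₁.sum ∈ L.comap q := by
        obtain ⟨y, hy, hy2⟩ := exists_two_nsmul_eq hoddα
          (x := 2 • (τ₀ - k • c - P₁.sum + Multiset.card P₁ • c - B₁.sum)) (H := L.comap q) (by
          have e1 := sum_sub_card_nsmul_mem (fun i hi => hAs i (Multiset.mem_of_le hP₂ hi))
          have e2 := sum_sub_card_nsmul_mem hAs
          have e3 : (rot A).sum ∈ L.comap q := sum_mem_of_forall hAr
          have e4 : B₂.sum ∈ L.comap q :=
            sum_mem_of_forall fun i hi => hAr i (Multiset.mem_of_le hB₂ hi)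
          convert (L.comap q).sub_mem ((L.comap q).sub_mem
            ((L.comap q).nsmul_mem ((L.comap q).add_mem e1 e4) 2) e2) e3 using 1
          have e5 : (Multiset.card P₁ + Multiset.card P₂) • c = (k + a) • c := by rw [hPk]
          rw [ha]
          simp only [add_nsmul, mul_nsmul, two_nsmul] at e5 hs hτ₀ ⊢
          rw [← sub_eq_zero] at e5 hs hτ₀ ⊢
          linear_combination (exp := 1) 2 * e5 - hs + hτ₀)
        rwa [← two_nsmul_injective hoddα hy2]
      obtain ⟨P', hP', hPk', B', hB', hsum⟩ := hrob
        ((P₁.map q).map (· - q c) + (B₁.filter fun i => i ∉ H₀).map q)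
        (add_le_add (Multiset.map_le_map (Multiset.map_le_map hP₁))
          (Multiset.map_le_map (Multiset.filter_le_filter _ hB₁))) _ hx
      refine hτ P' hP' hPk' B' hB' (hsum.trans ?_)
      have e6 : q (B₁.filter fun i => i ∉ H₀).sum = q B₁.sum := by
        conv_rhs => rw [← Multiset.filter_add_not (fun i => i ∈ H₀) B₁]
        rw [Multiset.sum_add, map_add, hq0 _ (sum_mem_of_forall fun i hi =>
          (Multiset.mem_filter.1 hi).2), zero_add]
      rw [Multiset.sum_add, sum_map_sub_const, Multiset.card_map, ← map_multiset_sum,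
        ← map_multiset_sum, e6]
      simp only [map_sub, map_add, map_nsmul]
      abel

end DihedralOmega

namespace DihedralOmega
open scoped Classical
open ProductOne DihedralGroup

@[to_additive]
lemma exists_segment_prod_eq_one {M : Type*} [Group M] [Finite M] (H : Subgroup M) (l : List M)
    (hl : ∀ x ∈ l, x ∈ H) (hlen : Nat.card H ≤ l.length) :
    ∃ l₁ l₂ l₃, l = l₁ ++ (l₂ ++ l₃) ∧ l₂ ≠ [] ∧ l₂.prod = 1 := by
  have hmem : ∀ i, (l.take i).prod ∈ H := fun i =>
    H.list_prod_mem fun x hx => hl x (List.mem_of_mem_take hx)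
  have key : ∃ i j, i < j ∧ j ≤ l.length ∧ (l.take i).prod = (l.take j).prod := by
    have := Fintype.ofFinite H
    obtain ⟨i, j, hij, h⟩ := Fintype.exists_ne_map_eq_of_card_lt
      (fun i : Fin (l.length + 1) => (⟨(l.take i).prod, hmem i⟩ : H))
      (by rw [Fintype.card_fin, ← Nat.card_eq_fintype_card]; omega)
    have h' := congrArg Subtype.val h
    rcases lt_or_gt_of_ne hij with hlt | hlt
    · exact ⟨i, j, hlt, Nat.lt_succ_iff.1 j.2, h'⟩
    · exact ⟨j, i, hlt, Nat.lt_succ_iff.1 i.2, h'.symm⟩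
  obtain ⟨i, j, hij, hj, h⟩ := key
  refine ⟨l.take i, (l.drop i).take (j - i), (l.drop i).drop (j - i), ?_, ?_, ?_⟩
  · rw [List.take_append_drop, List.take_append_drop]
  · intro h0
    have := congrArg List.length h0
    simp at this
    omega
  · have e : l.take j = l.take i ++ (l.drop i).take (j - i) := by
      rw [← List.take_add, Nat.add_sub_cancel' hij.le]
    rw [e, List.prod_append] at h
    exact (left_eq_mul.1 h)

lemma exists_zero_sum {α : Type*} [AddCommGroup α] [Finite α] {H : AddSubgroup α}
    {D : Multiset α} (hD : ∀ d ∈ D, d ∈ H) (hcard : Nat.card H ≤ Multiset.card D) :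
    ∃ t ≤ D, t ≠ 0 ∧ t.sum = 0 := by
  induction D using Quotient.inductionOn with
  | h l =>
    obtain ⟨l₁, l₂, l₃, rfl, h0, hs⟩ := exists_segment_sum_eq_zero H l (by simpa using hD)
      (by simpa using hcard)
    refine ⟨(l₂ : Multiset α), ?_, by simpa using h0, by simpa using hs⟩
    exact Multiset.coe_le.2
      ((List.sublist_append_left l₂ l₃).trans (List.sublist_append_right l₁ _)).subperm

lemma _root_.ProductOne.IsAtomSeq.card_le {G : Type*} [Group G] [Finite G] {U : Multiset G}
    (hU : IsAtomSeq U) : Multiset.card U ≤ Nat.card G := by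
  by_contra! hlt
  obtain ⟨h0, ⟨l, rfl, hl⟩, hmin⟩ := hU
  cases l with
  | nil => exact h0 rfl
  | cons g l =>
    obtain ⟨l₁, l₂, l₃, rfl, hne, hs⟩ := exists_segment_prod_eq_one (⊤ : Subgroup G) l
      (fun _ _ => Subgroup.mem_top _) (by
        rw [Subgroup.card_top]
        simpa [Nat.lt_succ_iff] using hlt)
    have := hmin l₂ (g :: (l₁ ++ l₃) : List G) (by
      simp only [← Multiset.cons_coe, ← Multiset.coe_add, ← Multiset.singleton_add]
      abel) ⟨l₂, rfl, hs⟩ ⟨_, rfl, by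
        rw [List.prod_cons, List.prod_append, List.prod_append, hs, one_mul] at hl
        rw [List.prod_cons, List.prod_append, hl]⟩
    rcases this with h | h
    · exact hne (by simpa using h)
    · simp at h

variable {n : ℕ}

lemma split_bound [NeZero n] {U : Multiset (DihedralGroup n)} (hU : IsAtomSeq U)
    {P Q R₁ R₂ : Multiset (ZMod n)} (hR : rot U = R₁ + R₂) (hF : refl U = P + Q)
    (hc : Multiset.card P = Multiset.card Q) (hs : P.sum + R₁.sum = Q.sum + R₂.sum)
    (H : AddSubgroup (ZMod n)) (c : ZMod n) {m : ℕ}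
    (hmP : m ≤ Multiset.card (P.filter fun i => i - c ∈ H))
    (hmQ : m ≤ Multiset.card (Q.filter fun i => i - c ∈ H)) (hm : m + 1 ≤ Multiset.card P) :
    m + Multiset.card (R₁.filter fun i => i ∈ H) + 1 ≤ Nat.card H := by
  by_contra! hlt
  obtain ⟨P', hP', hP'm⟩ := exists_le_card_eq _ hmP
  obtain ⟨Q', hQ', hQ'm⟩ := exists_le_card_eq _ hmQ
  obtain ⟨N, hN1, hN2⟩ : ∃ N : Multiset (ZMod n × ZMod n),
      N.map Prod.fst = P' ∧ N.map Prod.snd = Q' := by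
    refine ⟨(P'.toList.zip Q'.toList : List _), ?_, ?_⟩
    · rw [Multiset.map_coe, List.map_fst_zip (by simp [hP'm, hQ'm]), Multiset.coe_toList]
    · rw [Multiset.map_coe, List.map_snd_zip (by simp [hP'm, hQ'm]), Multiset.coe_toList]
  have hNm : Multiset.card N = m := by rw [← hP'm, ← hN1, Multiset.card_map]
  obtain ⟨t, ht, ht0, hts⟩ := exists_zero_sum (H := H)
    (D := diffs N + R₁.filter fun i => i ∈ H) (by
      intro d hd
      rcases Multiset.mem_add.1 hd with hd | hd
      · obtain ⟨x, hx, rfl⟩ := Multiset.mem_map.1 hd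
        have h1 := (Multiset.mem_filter.1 (Multiset.mem_of_le hP'
          (hN1 ▸ Multiset.mem_map_of_mem Prod.fst hx))).2
        have h2 := (Multiset.mem_filter.1 (Multiset.mem_of_le hQ'
          (hN2 ▸ Multiset.mem_map_of_mem Prod.snd hx))).2
        have := H.sub_mem h1 h2
        rwa [sub_sub_sub_cancel_right] at this
      · exact (Multiset.mem_filter.1 hd).2)
    (by rw [Multiset.card_add, diffs, Multiset.card_map]; omega)
  obtain ⟨u, v, hu, hv, rfl⟩ := exists_add_of_le_add ht
  obtain ⟨N', hN', rfl⟩ := exists_le_of_le_map hu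
  obtain ⟨P₁, rfl⟩ := Multiset.le_iff_exists_add.1 (((Multiset.map_le_map hN').trans
    (hN1.le.trans hP')).trans (Multiset.filter_le _ _) : N'.map Prod.fst ≤ P)
  obtain ⟨Q₁, rfl⟩ := Multiset.le_iff_exists_add.1 (((Multiset.map_le_map hN').trans
    (hN2.le.trans hQ')).trans (Multiset.filter_le _ _) : N'.map Prod.snd ≤ Q)
  obtain ⟨R', rfl⟩ := Multiset.le_iff_exists_add.1 (hv.trans (Multiset.filter_le _ _))
  have hNc := Multiset.card_le_card hN'
  have hdiff : (N'.map Prod.fst).sum + v.sum = (N'.map Prod.snd).sum := by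
    rw [Multiset.sum_add, Multiset.sum_map_sub] at hts
    rw [← sub_eq_zero, ← hts]; abel
  simp only [Multiset.card_add, Multiset.card_map] at hc hm
  have hsplit := hU.2.2 (assemble (v + 0) (N'.map Prod.fst + N'.map Prod.snd))
    (assemble (R' + R₂) (P₁ + Q₁)) (by
      rw [← assemble_add, ← assemble_rot_refl U, hR, hF]
      congr 1 <;> abel)
    (isProductOne_assemble (by simp) (by simp) (by simpa using hdiff))
    (isProductOne_assemble (fun h => by
      have := congrArg Multiset.card h
      simp only [Multiset.card_add, Multiset.card_zero] at this
      omega) (by omega) (by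
      simp only [Multiset.sum_add] at hs
      rw [← hdiff, ← sub_eq_zero] at hs
      rw [← sub_eq_zero, ← hs]; abel))
  rcases hsplit with h | h
  · have := congrArg Multiset.card h
    simp only [assemble, Multiset.card_add, Multiset.card_map, Multiset.card_zero] at this
    apply ht0
    rw [← Multiset.card_eq_zero, Multiset.card_add, Multiset.card_map]
    omega
  · have := congrArg Multiset.card h
    simp only [assemble, Multiset.card_add, Multiset.card_map, Multiset.card_zero] at this
    omega

/-- The exponents of the rotations in a subgroup. -/
def rotationPart (K : Subgroup (DihedralGroup n)) : AddSubgroup (ZMod n) where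
  carrier := {i | r i ∈ K}
  zero_mem' := K.one_mem
  add_mem' {i j} hi hj := by
    change r (i + j) ∈ K
    rw [← r_mul_r]
    exact K.mul_mem hi hj
  neg_mem' {i} hi := K.inv_mem hi

lemma mem_rotationPart {K : Subgroup (DihedralGroup n)} {i : ZMod n} :
    i ∈ rotationPart K ↔ r i ∈ K := Iff.rfl

lemma sr_mem_iff {K : Subgroup (DihedralGroup n)} {c : ZMod n} (hc : sr c ∈ K) {i : ZMod n} :
    sr i ∈ K ↔ i - c ∈ rotationPart K := by
  rw [mem_rotationPart, ← sr_mul_sr]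
  exact (K.mul_mem_cancel_left hc).symm

lemma index_mul_card_rotationPart [NeZero n] (K : Subgroup (DihedralGroup n)) :
    K.index * Nat.card (rotationPart K) ≤ 2 * n := by
  rw [← natCard_dihedral, ← K.index_mul_card]
  refine Nat.mul_le_mul_left _ (Nat.card_le_card_of_injective
    (fun i : rotationPart K => (⟨r i, i.2⟩ : K)) fun i j h => ?_)
  exact Subtype.ext (r.inj (congrArg Subtype.val h))

lemma index_mul_card_rotationPart_of_sr_mem [NeZero n] {K : Subgroup (DihedralGroup n)}
    {c : ZMod n} (hc : sr c ∈ K) : K.index * Nat.card (rotationPart K) ≤ n := by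
  have h : 2 * Nat.card (rotationPart K) ≤ Nat.card K := by
    rw [two_mul, ← Nat.card_sum]
    refine Nat.card_le_card_of_injective (Sum.elim
      (fun i : rotationPart K => (⟨r i, i.2⟩ : K))
      (fun i : rotationPart K => (⟨sr c * r i, K.mul_mem hc (mem_rotationPart.1 i.2)⟩ : K))) ?_
    rintro (i | i) (j | j) hij <;> have hij := congrArg Subtype.val hij
    · exact congrArg Sum.inl (Subtype.ext (r.inj hij))
    · cases hij
    · cases hij
    · exact congrArg Sum.inr (Subtype.ext (r.inj (mul_left_cancel hij)))
  have h1 := Nat.mul_le_mul_left K.index h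
  rw [K.index_mul_card, natCard_dihedral, Nat.mul_left_comm] at h1
  omega

lemma card_le_of_refl_eq_zero [NeZero n] {U : Multiset (DihedralGroup n)} (hU : IsAtomSeq U)
    (h : refl U = 0) : Multiset.card U ≤ n := by
  by_contra! hlt
  rw [← card_rot_add_card_refl, h, Multiset.card_zero, add_zero] at hlt
  obtain ⟨D, hD, hDn⟩ := exists_le_card_eq _ hlt.le
  obtain ⟨t, ht, ht0, hts⟩ := exists_zero_sum (H := (⊤ : AddSubgroup (ZMod n))) (D := D)
    (fun _ _ => AddSubgroup.mem_top _) (by rw [AddSubgroup.card_top, Nat.card_zmod, hDn])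
  obtain ⟨R', hR'⟩ := Multiset.le_iff_exists_add.1 (ht.trans hD)
  have h0 := (isProductOne_iff_of_refl_eq_zero h).1 hU.2.1
  rw [hR', Multiset.sum_add, hts, zero_add] at h0
  rcases hU.2.2 (assemble t 0) (assemble R' 0)
    (by rw [← assemble_add, ← hR', zero_add, ← h, assemble_rot_refl])
    ((isProductOne_iff_of_refl_eq_zero (by simp)).2 (by simpa using hts))
    ((isProductOne_iff_of_refl_eq_zero (by simp)).2 (by simpa using h0)) with h | h
  · exact ht0 (by simpa using congrArg rot h)
  · have h1 : R' = 0 := by simpa using congrArg rot h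
    have h2 := Multiset.card_le_card ht
    rw [hR', h1, add_zero] at hlt
    omega

theorem card_add_card_filter_add_index_le [NeZero n] {U : Multiset (DihedralGroup n)}
    (hU : IsAtomSeq U) (K : Subgroup (DihedralGroup n)) :
    Multiset.card U + Multiset.card (U.filter fun g => g ∈ K) + K.index ≤ 4 * n + 1 := by
  have hU2 := hU.card_le
  rw [natCard_dihedral] at hU2
  have hv := Multiset.card_le_card (Multiset.filter_le (fun g => g ∈ K) U)
  set H := rotationPart K with hH
  have hpos : 0 < Nat.card H := Nat.card_pos
  have hi1 := index_mul_card_rotationPart K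
  have hi2 : K.index ≤ 2 * n := (Nat.le_mul_of_pos_right _ hpos).trans hi1
  have hi0 : 0 < K.index := Nat.pos_of_ne_zero K.index_ne_zero_of_finite
  by_cases hF0 : refl U = 0
  · have := card_le_of_refl_eq_zero hU hF0
    omega
  obtain ⟨P, Q, R₁, R₂, hR, hF, -, hc, hs⟩ := hU.2.1.exists_split
  have hP : 0 < Multiset.card P := by
    by_contra! h
    have : P + Q = 0 := by
      rw [← Multiset.card_eq_zero, Multiset.card_add]; omega
    exact hF0 (hF.trans this)
  have hUc : Multiset.card U = Multiset.card R₁ + Multiset.card R₂ +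
      (Multiset.card P + Multiset.card Q) := by
    rw [← card_rot_add_card_refl, hR, hF, Multiset.card_add, Multiset.card_add]
  have hx := Multiset.card_le_card (Multiset.filter_le (fun i => i ∈ H) R₁)
  have hy := Multiset.card_le_card (Multiset.filter_le (fun i => i ∈ H) R₂)
  have hrotf : Multiset.card ((rot U).filter fun i => r i ∈ K) =
      Multiset.card (R₁.filter fun i => i ∈ H) + Multiset.card (R₂.filter fun i => i ∈ H) := by
    rw [hR, Multiset.filter_add, Multiset.card_add]; rfl
  rw [card_filter_eq, hrotf]
  by_cases hsr : ∃ c, sr c ∈ K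
  · obtain ⟨c, hcK⟩ := hsr
    have hi := index_mul_card_rotationPart_of_sr_mem hcK
    rw [← hH] at hi
    simp only [sr_mem_iff hcK, ← hH]
    have hp := Multiset.card_le_card (Multiset.filter_le (fun i => i - c ∈ H) P)
    have hq := Multiset.card_le_card (Multiset.filter_le (fun i => i - c ∈ H) Q)
    have b1 := split_bound (m := min (min (Multiset.card (P.filter fun i => i - c ∈ H))
      (Multiset.card (Q.filter fun i => i - c ∈ H))) (Multiset.card P - 1))
      hU hR hF hc hs H c (by omega) (by omega) (by omega)
    have b2 := split_bound (m := min (min (Multiset.card (P.filter fun i => i - c ∈ H))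
      (Multiset.card (Q.filter fun i => i - c ∈ H))) (Multiset.card P - 1))
      hU (hR.trans (add_comm _ _)) (hF.trans (add_comm _ _)) hc.symm hs.symm H c
      (by omega) (by omega) (by omega)
    rw [hF, Multiset.filter_add, Multiset.card_add]
    have e1 : K.index + Nat.card H ≤ n + 1 := by nlinarith
    have e2 : K.index + 2 * Nat.card H ≤ 2 * n + 1 := by
      rcases Nat.lt_or_ge K.index 2 with h | h
      · have : K.index = 1 := by omega
        rw [this] at hi ⊢; omega
      · nlinarith
    omega
  · have e0 : (refl U).filter (fun i => sr i ∈ K) = 0 :=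
      Multiset.filter_eq_nil.2 fun i _ hi => hsr ⟨i, hi⟩
    rw [e0, Multiset.card_zero]
    have b1 := split_bound (m := 0) hU hR hF hc hs H 0 (by omega) (by omega) (by omega)
    have b2 := split_bound (m := 0) hU (hR.trans (add_comm _ _)) (hF.trans (add_comm _ _))
      hc.symm hs.symm H 0 (by omega) (by omega) (by omega)
    rw [← hH] at hi1
    have e1 : K.index + 2 * Nat.card H ≤ 2 * n + 2 := by
      rcases Nat.lt_or_ge K.index 2 with h | h
      · have := Nat.le_of_dvd (Nat.pos_of_ne_zero (NeZero.ne n))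
          (Nat.card_zmod n ▸ AddSubgroup.card_addSubgroup_dvd_card H)
        omega
      · nlinarith
    omega

end DihedralOmega

namespace DihedralOmega
open scoped Classical
open ProductOne DihedralGroup

section Group

variable {G : Type*} [Group G]

lemma mem_of_isProductOne_cons {K : Subgroup G} {g : G} {A : Multiset G}
    (h : IsProductOne (g ::ₘ A)) (hA : ∀ x ∈ A, x ∈ K) : g ∈ K := by
  obtain ⟨l, hl, hp⟩ := h
  obtain ⟨l₁, l₂, rfl⟩ := List.append_of_mem
    (show g ∈ l by rw [← Multiset.mem_coe, hl]; exact Multiset.mem_cons_self _ _)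
  have hA' : ((l₁ ++ l₂ : List G) : Multiset G) = A := by
    rw [← Multiset.cons_inj_right g, ← hl, Multiset.cons_coe, Multiset.coe_eq_coe]
    exact List.perm_middle.symm
  have h1 : l₁.prod ∈ K := K.list_prod_mem fun x hx =>
    hA x (by rw [← hA']; simp [hx])
  have h2 : l₂.prod ∈ K := K.list_prod_mem fun x hx =>
    hA x (by rw [← hA']; simp [hx])
  rw [List.prod_append, List.prod_cons] at hp
  have := K.one_mem
  rwa [← hp, K.mul_mem_cancel_left h1, K.mul_mem_cancel_right h2] at this

lemma card_filter_ne_one {K : Subgroup G} {A : Multiset G} (h : IsProductOne A) :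
    Multiset.card (A.filter fun g => g ∉ K) ≠ 1 := by
  intro h1
  obtain ⟨g, hg⟩ := Multiset.card_eq_one.1 h1
  have hA := Multiset.filter_add_not (fun g => g ∉ K) A
  rw [hg, Multiset.singleton_add] at hA
  rw [← hA] at h
  have hgK : g ∉ K := (Multiset.mem_filter.1
    (show g ∈ A.filter fun g => g ∉ K from hg ▸ Multiset.mem_singleton_self g)).2
  exact hgK (mem_of_isProductOne_cons h fun x hx => not_not.1 (Multiset.mem_filter.1 hx).2)

lemma exists_blocks {α : Type*} (t : Multiset (Multiset α)) {U C : Multiset α}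
    (h : U + C = t.sum) : ∃ N : Multiset (Multiset α × Multiset α),
      N.map (fun p => p.1 + p.2) = t ∧ (N.map Prod.fst).sum = U ∧ (N.map Prod.snd).sum = C := by
  induction t using Multiset.induction_on generalizing U C with
  | empty =>
    obtain ⟨rfl, rfl⟩ := add_eq_zero.1 (h.trans Multiset.sum_zero)
    exact ⟨0, rfl, rfl, rfl⟩
  | cons A t ih =>
    rw [Multiset.sum_cons] at h
    obtain ⟨u, v, hu, hv, rfl⟩ := exists_add_of_le_add ((Multiset.le_add_right U C).trans h.le)
    obtain ⟨c, rfl⟩ := Multiset.le_iff_exists_add.1 hu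
    obtain ⟨d, hd⟩ := Multiset.le_iff_exists_add.1 hv
    obtain ⟨N, hN, h1, h2⟩ := ih hd.symm
    refine ⟨(u, c) ::ₘ N, by simp [hN], by simp [h1], ?_⟩
    rw [hd] at h
    have : C = c + d := add_left_cancel (a := u + v) (h.trans (by abel))
    simp [h2, this]

lemma card_filter_sum {α : Type*} (p : α → Prop) [DecidablePred p]
    (t : Multiset (Multiset α)) :
    Multiset.card (t.sum.filter p) = (t.map fun A => Multiset.card (A.filter p)).sum := by
  induction t using Multiset.induction_on with
  | empty => simp
  | cons A t ih => simp [ih]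

/-- The number of terms outside `K` of the second components, counting at most two per pair. -/
noncomputable def outside (N : Multiset (Multiset G × Multiset G)) (K : Subgroup G) : ℕ :=
  (N.map fun p => min 2 (Multiset.card (p.2.filter fun g => g ∉ K))).sum

lemma outside_inf_le (N : Multiset (Multiset G × Multiset G)) (K L : Subgroup G) :
    outside N (K ⊓ L) ≤ outside N K + outside N L := by
  rw [outside, outside, outside, ← Multiset.sum_map_add]
  refine Multiset.sum_map_le_sum_map _ _ fun p _ => ?_
  have h : Multiset.card (p.2.filter fun g => g ∉ K ⊓ L) ≤
      Multiset.card (p.2.filter fun g => g ∉ K) + Multiset.card (p.2.filter fun g => g ∉ L) := by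
    rw [← Multiset.card_add, Multiset.filter_add_filter, Multiset.card_add]
    refine le_trans (Multiset.card_le_card (Multiset.monotone_filter_right _ fun g hg => ?_))
      (Nat.le_add_right _ _)
    by_contra! hcon
    exact hg hcon
  omega

lemma outside_cons_le (N : Multiset (Multiset G × Multiset G)) (p) (K : Subgroup G) :
    outside (p ::ₘ N) K ≤
      Multiset.card ((N.map Prod.snd).sum.filter fun g => g ∉ K) + 2 := by
  rw [outside, Multiset.map_cons, Multiset.sum_cons, card_filter_sum, Multiset.map_map, add_comm]
  exact add_le_add (Multiset.sum_map_le_sum_map _ _ fun p _ => min_le_right _ _) (min_le_left _ _)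

lemma two_mul_index_le [Finite G] {K L : Subgroup G} (h : K < L) : 2 * L.index ≤ K.index := by
  obtain ⟨m, hm⟩ := Subgroup.index_dvd_of_le h.le
  have h1 := Subgroup.index_strictAnti h
  rw [hm] at h1 ⊢
  have h2 : 1 < m := by
    by_contra! hle
    exact absurd h1 (not_lt.2 (by simpa using Nat.mul_le_mul_left L.index hle))
  rw [mul_comm]
  exact Nat.mul_le_mul_left _ h2

end Group

variable {n : ℕ}

theorem exists_small_subproduct [NeZero n] (hodd : Odd n) {U : Multiset (DihedralGroup n)}
    (hU : IsAtomSeq U) {f : Multiset (Multiset (DihedralGroup n))}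
    (hf : ∀ B ∈ f, IsProductOne B) (hdvd : BDvd U f.sum) :
    ∃ t ≤ f, Multiset.card t ≤ 2 * n ∧ BDvd U t.sum := by
  obtain ⟨t, ⟨htf, htU⟩, hmin⟩ := WellFounded.has_min
    (wellFounded_lt (α := Multiset (Multiset (DihedralGroup n)))) {t | t ≤ f ∧ BDvd U t.sum}
    ⟨f, le_rfl, hdvd⟩
  refine ⟨t, htf, ?_, htU⟩
  by_contra! hlt
  obtain ⟨C, hC, htC⟩ := htU
  obtain ⟨N, hN, hNU, hNC⟩ := exists_blocks t htC.symm
  have hcardN : Multiset.card N = Multiset.card t := by rw [← hN, Multiset.card_map]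
  have hprod : ∀ p ∈ N, IsProductOne (p.1 + p.2) := fun p hp =>
    hf _ (Multiset.mem_of_le htf (hN ▸ Multiset.mem_map_of_mem _ hp))
  have hUcard : Multiset.card U = (N.map fun p => Multiset.card p.1).sum := by
    rw [← hNU]; exact (Multiset.card_join _).trans (by rw [Multiset.map_map]; rfl)
  have hU2 := hU.card_le
  rw [natCard_dihedral] at hU2
  have hgood : ∀ p ∈ N, p.1 = 0 → ∃ K : Subgroup (DihedralGroup n),
      outside N K ≤ K.index ∧ ∃ g ∈ p.2, g ∉ K := by
    intro p hp hp0
    obtain ⟨N', hN'⟩ := Multiset.exists_cons_of_mem hp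
    have hsum : (N'.map Prod.snd).sum + p.2 = C := by
      rw [← hNC, hN', Multiset.map_cons, Multiset.sum_cons, add_comm]
    obtain ⟨K, hK, hg⟩ := exists_subgroup_of_not_isProductOne hodd
      (C := (N'.map Prod.snd).sum) (A := p.2) (by simpa [hp0] using hprod p hp)
      (by rwa [hsum]) (fun hcon => by
        have ht' : t = p.2 ::ₘ N'.map (fun p => p.1 + p.2) := by
          rw [← hN, hN', Multiset.map_cons, hp0, zero_add]
        refine hmin (N'.map fun p => p.1 + p.2) ⟨?_, _, hcon, ?_⟩ ?_
        · exact (Multiset.le_cons_self _ p.2).trans (ht' ▸ htf)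
        · rw [Multiset.sum_map_add, ← hNU, hN', Multiset.map_cons, Multiset.sum_cons, hp0,
            zero_add]
        · rw [ht']
          exact Multiset.lt_cons_self _ _)
    exact ⟨K, (hN' ▸ outside_cons_le N' p K).trans hK, hg⟩
  obtain ⟨o, ho, ho0⟩ : ∃ p ∈ N, p.1 = 0 := by
    by_contra! hcon
    have : Multiset.card N • 1 ≤ (N.map fun p => Multiset.card p.1).sum := by
      rw [← Multiset.card_map (fun p => Multiset.card p.1) N]
      refine Multiset.card_nsmul_le_sum fun x hx => ?_
      obtain ⟨p, hp, rfl⟩ := Multiset.mem_map.1 hx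
      exact Multiset.card_pos.2 (hcon p hp)
    rw [smul_eq_mul] at this
    omega
  obtain ⟨K₀, hK₀, -⟩ := hgood o ho ho0
  obtain ⟨K, hK, hKmin⟩ := WellFounded.has_min
    (wellFounded_lt (α := Subgroup (DihedralGroup n))) {K | outside N K ≤ K.index} ⟨K₀, hK₀⟩
  have hout : ∀ p ∈ N, p.1 = 0 → ∃ g ∈ p.2, g ∉ K := by
    intro p hp hp0
    obtain ⟨L, hL, g, hg, hgL⟩ := hgood p hp hp0
    refine ⟨g, hg, fun hgK => hgL ?_⟩
    suffices K ≤ L from this hgK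
    by_contra hKL
    have h1 : K ⊓ L < K := inf_lt_left.2 hKL
    by_cases hLK : L ≤ K
    · exact hKmin L hL (lt_of_le_not_ge hLK hKL)
    · have h2 : K ⊓ L < L := inf_lt_right.2 hLK
      have e1 := two_mul_index_le h1
      have e2 := two_mul_index_le h2
      have e3 := outside_inf_le N K L
      refine hKmin (K ⊓ L) ?_ h1
      change outside N K ≤ K.index at hK
      change outside N (K ⊓ L) ≤ (K ⊓ L).index
      omega
  have hcount : Multiset.card N • 2 ≤ Multiset.card U +
      Multiset.card (U.filter fun g => g ∈ K) + outside N K := by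
    have hUf : Multiset.card (U.filter fun g => g ∈ K) =
        (N.map fun p => Multiset.card (p.1.filter fun g => g ∈ K)).sum := by
      rw [← hNU, card_filter_sum, Multiset.map_map]; rfl
    rw [hUcard, hUf, outside, ← Multiset.sum_map_add, ← Multiset.sum_map_add,
      ← Multiset.card_map (fun p => Multiset.card p.1 +
        Multiset.card (p.1.filter fun g => g ∈ K) +
        min 2 (Multiset.card (p.2.filter fun g => g ∉ K))) N]
    refine Multiset.card_nsmul_le_sum fun x hx => ?_
    obtain ⟨⟨u, c⟩, hp, rfl⟩ := Multiset.mem_map.1 hx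
    have h1 := card_filter_ne_one (K := K) (hprod _ hp)
    have h2 := congrArg Multiset.card (Multiset.filter_add_not (fun g => g ∈ K) u)
    rw [Multiset.card_add] at h2
    dsimp only at h1 h2 ⊢
    rw [Multiset.filter_add, Multiset.card_add] at h1
    rcases Multiset.empty_or_exists_mem u with hu0 | ⟨x, hx⟩
    · obtain ⟨g, hg, hgK⟩ := hout _ hp hu0
      have h3 : 0 < Multiset.card (c.filter fun g => g ∉ K) :=
        Multiset.card_pos_iff_exists_mem.2 ⟨g, Multiset.mem_filter.2 ⟨hg, hgK⟩⟩
      subst hu0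
      simp at h1 ⊢
      omega
    · have h3 : 0 < Multiset.card u := Multiset.card_pos_iff_exists_mem.2 ⟨x, hx⟩
      omega
  have hfinal := card_add_card_filter_add_index_le hU K
  change outside N K ≤ K.index at hK
  rw [smul_eq_mul] at hcount
  omega

end DihedralOmega

namespace DihedralOmega
open scoped Classical
open ProductOne

lemma factDist_eq {G : Type*} (x y : Multiset (Multiset G)) :
    factDist x y = max (Multiset.card (x - y)) (Multiset.card (y - x)) := by
  unfold factDist
  congr!

lemma factDist_cons {G : Type*} (u : Multiset G) (x y : Multiset (Multiset G)) :
    factDist (u ::ₘ x) (u ::ₘ y) = factDist x y := by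
  simp [factDist_eq, ← Multiset.singleton_add, add_tsub_add_eq_tsub_left]

lemma factDist_le_max {G : Type*} (x y : Multiset (Multiset G)) :
    factDist x y ≤ max (Multiset.card x) (Multiset.card y) := by
  rw [factDist_eq]
  exact max_le_max (Multiset.card_le_card (Multiset.sub_le_self _ _))
    (Multiset.card_le_card (Multiset.sub_le_self _ _))

variable {G : Type*} [Group G]

lemma exists_isFactorization {A : Multiset G} (hA : IsProductOne A) :
    ∃ z, IsFactorization A z := by
  induction A using Multiset.strongInductionOn with
  | ih A ih =>
    by_cases h0 : A = 0
    · exact ⟨0, by simp, by simp [h0]⟩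
    by_cases hat : IsAtomSeq A
    · exact ⟨{A}, by simpa using hat, by simp⟩
    obtain ⟨B, C, rfl, hB, hC, hB0, hC0⟩ : ∃ B C, A = B + C ∧ IsProductOne B ∧ IsProductOne C ∧
        B ≠ 0 ∧ C ≠ 0 := by
      by_contra! hcon
      exact hat ⟨h0, hA, fun B C hBC hB hC => or_iff_not_imp_left.2 (hcon B C hBC hB hC)⟩
    obtain ⟨z, hz, hzs⟩ := ih B (lt_add_of_pos_right _ (pos_iff_ne_zero.2 hC0)) hB
    obtain ⟨w, hw, hws⟩ := ih C (lt_add_of_pos_left _ (pos_iff_ne_zero.2 hB0)) hC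
    refine ⟨z + w, fun U hU => ?_, by rw [Multiset.sum_add, hzs, hws]⟩
    exact (Multiset.mem_add.1 hU).elim (hz U) (hw U)

lemma eq_zero_of_sum_eq_zero {z : Multiset (Multiset G)} (hz : ∀ U ∈ z, IsAtomSeq U)
    (h : z.sum = 0) : z = 0 :=
  Multiset.eq_zero_of_forall_notMem fun U hU =>
    (hz U hU).1 (Multiset.le_zero.1 (h ▸ Multiset.le_sum_of_mem hU))

lemma isProductOne_sum {z : Multiset (Multiset G)} (hz : ∀ U ∈ z, IsProductOne U) :
    IsProductOne z.sum := by
  induction z using Multiset.induction_on with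
  | empty => exact isProductOne_zero
  | cons U z ih =>
    rw [Multiset.sum_cons]
    exact (hz U (Multiset.mem_cons_self _ _)).add
      (ih fun V hV => hz V (Multiset.mem_cons_of_mem hV))

/-- Two factorizations of `A` are connected by a chain of factorizations with steps at most `N`. -/
def Connected (A : Multiset G) (N : ℕ∞) (z z' : Multiset (Multiset G)) : Prop :=
  Relation.ReflTransGen (fun x y => IsFactorization A y ∧ (factDist x y : ℕ∞) ≤ N) z z'

lemma Connected.cons {A : Multiset G} {N : ℕ∞} {z z' : Multiset (Multiset G)}
    (h : Connected A N z z') {u : Multiset G} (hu : IsAtomSeq u) :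
    Connected (u + A) N (u ::ₘ z) (u ::ₘ z') := by
  refine Relation.ReflTransGen.lift (u ::ₘ ·) (fun x y hxy => ⟨⟨fun V hV => ?_, ?_⟩, ?_⟩) _ _ h
  · rcases Multiset.mem_cons.1 hV with rfl | hV
    · exact hu
    · exact hxy.1.1 V hV
  · rw [Multiset.sum_cons, hxy.1.2]
  · rw [factDist_cons]; exact hxy.2

lemma connected_of_omega {N : ℕ} (hω : ∀ U : Multiset G, IsAtomSeq U →
      ∀ f : Multiset (Multiset G), (∀ B ∈ f, IsProductOne B) → BDvd U f.sum →
        ∃ t ≤ f, Multiset.card t ≤ N ∧ BDvd U t.sum) (A : Multiset G) :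
    ∀ z z', IsFactorization A z → IsFactorization A z' → Connected A N z z' := by
  induction A using Multiset.strongInductionOn with
  | ih A ih =>
    have hcommon : ∀ u z z', IsFactorization A z → IsFactorization A z' → u ∈ z → u ∈ z' →
        Connected A N z z' := by
      intro u z z' hz hz' huz huz'
      obtain ⟨z, rfl⟩ := Multiset.exists_cons_of_mem huz
      obtain ⟨z', rfl⟩ := Multiset.exists_cons_of_mem huz'
      have hu := hz.1 u huz
      have h1 : u + z.sum = A := by rw [← Multiset.sum_cons, hz.2]
      have h2 : u + z'.sum = A := by rw [← Multiset.sum_cons, hz'.2]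
      have := (ih z.sum (by rw [← h1]; exact lt_add_of_pos_left _ (pos_iff_ne_zero.2 hu.1)) z z'
        ⟨fun V hV => hz.1 V (Multiset.mem_cons_of_mem hV), rfl⟩
        ⟨fun V hV => hz'.1 V (Multiset.mem_cons_of_mem hV),
          add_left_cancel (h2.trans h1.symm)⟩).cons hu
      rwa [h1] at this
    have hbridge : ∀ z z', IsFactorization A z → IsFactorization A z' → N < Multiset.card z →
        ∃ z'', IsFactorization A z'' ∧ (∃ u ∈ z, u ∈ z'') ∧ ∃ v ∈ z', v ∈ z'' := by
      intro z z' hz hz' hN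
      obtain ⟨v, hv⟩ : ∃ v, v ∈ z' := by
        refine Multiset.exists_mem_of_ne_zero ?_
        rintro rfl
        have hA0 : A = 0 := hz'.2.symm
        rw [eq_zero_of_sum_eq_zero hz.1 (hz.2.trans hA0)] at hN
        simp at hN
      obtain ⟨s', hs'⟩ := Multiset.exists_cons_of_mem hv
      obtain ⟨t, ht, htN, C, hC, htC⟩ := hω v (hz'.1 v hv) z (fun B hB => (hz.1 B hB).2.1)
        ⟨s'.sum, isProductOne_sum fun B hB => (hz'.1 B (hs' ▸ Multiset.mem_cons_of_mem hB)).2.1,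
          by rw [hz.2, ← hz'.2, hs', Multiset.sum_cons]⟩
      obtain ⟨s, rfl⟩ := Multiset.le_iff_exists_add.1 ht
      obtain ⟨u, hu⟩ : ∃ u, u ∈ s := by
        refine Multiset.exists_mem_of_ne_zero ?_
        rintro rfl
        rw [add_zero] at hN
        omega
      obtain ⟨w, hw, hws⟩ := exists_isFactorization hC
      refine ⟨v ::ₘ w + s, ⟨fun U hU => ?_, ?_⟩, ⟨u, by simp [hu], by simp [hu]⟩, v, hv, by simp⟩
      · rcases Multiset.mem_add.1 hU with hU | hU
        · rcases Multiset.mem_cons.1 hU with rfl | hU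
          · exact hz'.1 _ hv
          · exact hw U hU
        · exact hz.1 U (Multiset.mem_add.2 (Or.inr hU))
      · rw [← hz.2, Multiset.sum_add, Multiset.sum_add, Multiset.sum_cons, hws, htC]
    intro z z' hz hz'
    rcases lt_or_ge N (Multiset.card z) with h | h
    · obtain ⟨z'', hz'', ⟨u, hu, hu'⟩, v, hv, hv'⟩ := hbridge z z' hz hz' h
      exact (hcommon u z z'' hz hz'' hu hu').trans (hcommon v z'' z' hz'' hz' hv' hv)
    rcases lt_or_ge N (Multiset.card z') with h' | h'
    · obtain ⟨z'', hz'', ⟨u, hu, hu'⟩, v, hv, hv'⟩ := hbridge z' z hz' hz h'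
      exact (hcommon v z z'' hz hz'' hv hv').trans (hcommon u z'' z' hz'' hz' hu' hu)
    exact Relation.ReflTransGen.single
      ⟨hz', by exact_mod_cast (factDist_le_max z z').trans (max_le h h')⟩

lemma two_add_card_le_factDist {A : Multiset G} {x y : Multiset (Multiset G)}
    (hx : IsFactorization A x) (hy : IsFactorization A y)
    (hlt : Multiset.card x < Multiset.card y) :
    Multiset.card y - Multiset.card x + 2 ≤ factDist x y := by
  have h1 : x - y + x ∩ y = x := Multiset.sub_add_inter x y
  have h2 : y - x + x ∩ y = y := by rw [Multiset.inter_comm]; exact Multiset.sub_add_inter y x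
  have hsum : (x - y).sum = (y - x).sum := by
    have e1 := congrArg Multiset.sum h1
    have e2 := congrArg Multiset.sum h2
    rw [Multiset.sum_add, hx.2] at e1
    rw [Multiset.sum_add, hy.2, ← e1] at e2
    exact (add_right_cancel e2).symm
  have c1 := congrArg Multiset.card h1
  have c2 := congrArg Multiset.card h2
  rw [Multiset.card_add] at c1 c2
  have hd : Multiset.card (y - x) ≤ factDist x y := by
    rw [factDist_eq]
    exact le_max_right _ _
  have hx' : ∀ U ∈ x - y, IsAtomSeq U := fun U hU =>
    hx.1 U (Multiset.mem_of_le (Multiset.sub_le_self _ _) hU)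
  have hy' : ∀ U ∈ y - x, IsAtomSeq U := fun U hU =>
    hy.1 U (Multiset.mem_of_le (Multiset.sub_le_self _ _) hU)
  suffices 2 ≤ Multiset.card (x - y) by omega
  by_contra! hlt2
  interval_cases hc : Multiset.card (x - y)
  · rw [Multiset.card_eq_zero] at hc
    rw [hc, Multiset.sum_zero] at hsum
    have := congrArg Multiset.card (eq_zero_of_sum_eq_zero hy' hsum.symm)
    rw [Multiset.card_zero] at this
    omega
  · obtain ⟨u, hu⟩ := Multiset.card_eq_one.1 hc
    rw [hu, Multiset.sum_singleton] at hsum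
    have hua : IsAtomSeq u := hx' u (hu ▸ Multiset.mem_singleton_self u)
    obtain ⟨v, hv⟩ : ∃ v, v ∈ y - x := Multiset.card_pos_iff_exists_mem.1 (by omega)
    obtain ⟨s, hs⟩ := Multiset.exists_cons_of_mem hv
    have hsa : ∀ U ∈ s, IsAtomSeq U := fun U hU => hy' U (hs ▸ Multiset.mem_cons_of_mem hU)
    rw [hs, Multiset.sum_cons] at hsum
    rcases hua.2.2 v s.sum hsum (hy' v hv).2.1
      (isProductOne_sum fun U hU => (hsa U hU).2.1) with h | h
    · exact (hy' v hv).1 h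
    · rw [hs, eq_zero_of_sum_eq_zero hsa h] at c2
      simp at c2
      omega

lemma mem_lengthsOn_univ {A : Multiset G} {k : ℕ} :
    k ∈ lengthsOn Set.univ A ↔ ∃ z, Multiset.card z = k ∧ IsFactorization A z := by
  constructor
  · rintro ⟨z, hz, hza, hzs⟩
    exact ⟨z, hz, fun U hU => (hza U hU).2, hzs⟩
  · rintro ⟨z, hz, hza, hzs⟩
    exact ⟨z, hz, fun U hU => ⟨fun _ _ => trivial, hza U hU⟩, hzs⟩

lemma lengthsOn_eq {G₀ : Set G} {A : Multiset G} (hA : SeqOn G₀ A) :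
    lengthsOn G₀ A = lengthsOn Set.univ A := by
  ext k
  rw [mem_lengthsOn_univ]
  constructor
  · rintro ⟨z, hz, hza, hzs⟩
    exact ⟨z, hz, fun U hU => (hza U hU).2, hzs⟩
  · rintro ⟨z, hz, hza, hzs⟩
    exact ⟨z, hz, fun U hU => ⟨fun g hg => hA g
      (hzs ▸ Multiset.mem_of_le (Multiset.le_sum_of_mem hU) hg), hza U hU⟩, hzs⟩

lemma deltaOn_subset (G₀ : Set G) : DeltaOn G₀ ⊆ Delta G := by
  rintro d ⟨A, hA, hA1, hd⟩
  exact ⟨A, fun _ _ => trivial, hA1, by rwa [← lengthsOn_eq hA]⟩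

lemma distance_add_two_le {A : Multiset G} {N : ℕ∞}
    (hconn : ∀ z z', IsFactorization A z → IsFactorization A z' → Connected A N z z') {d : ℕ}
    (hd : d ∈ distancesOf (lengthsOn Set.univ A)) : ((d + 2 : ℕ) : ℕ∞) ≤ N := by
  obtain ⟨hd0, a, ha, had, hgap⟩ := hd
  obtain ⟨z, hz, hzf⟩ := mem_lengthsOn_univ.1 ha
  obtain ⟨z', hz', hzf'⟩ := mem_lengthsOn_univ.1 had
  by_contra hcon
  have key : ∀ y, Connected A N z y → IsFactorization A y ∧ Multiset.card y ≤ a := by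
    intro y hy
    induction hy with
    | refl => exact ⟨hzf, hz.le⟩
    | tail _ hstep ih =>
      refine ⟨hstep.1, ?_⟩
      by_contra! hlt
      have h1 := two_add_card_le_factDist ih.1 hstep.1 (by omega)
      have h2 := hgap _ (mem_lengthsOn_univ.2 ⟨_, rfl, hstep.1⟩)
      refine hcon (le_trans ?_ hstep.2)
      exact_mod_cast (show d + 2 ≤ _ by omega : d + 2 ≤ _)
  have := (key z' (hconn z z' hzf hzf')).2
  omega

end DihedralOmega

namespace DihedralOmega
open scoped Classical
open ProductOne DihedralGroup

lemma exists_eq_replicate_add_replicate {α : Type*} {x y : α} {S : Multiset α}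
    (h : ∀ g ∈ S, g = x ∨ g = y) :
    ∃ a b, S = Multiset.replicate a x + Multiset.replicate b y := by
  induction S using Multiset.induction_on with
  | empty => exact ⟨0, 0, by simp⟩
  | cons g S ih =>
    obtain ⟨a, b, rfl⟩ := ih fun u hu => h u (Multiset.mem_cons_of_mem hu)
    rcases h g (Multiset.mem_cons_self _ _) with rfl | rfl
    · exact ⟨a + 1, b, by rw [Multiset.replicate_succ, Multiset.cons_add]⟩
    · exact ⟨a, b + 1, by rw [Multiset.replicate_succ, Multiset.add_cons]⟩

variable {n : ℕ}

/-- The sequence consisting of `a` copies of `sr 0` and `b` copies of `sr 1`. -/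
def mirrors (n a b : ℕ) : Multiset (DihedralGroup n) :=
  Multiset.replicate a (sr 0) + Multiset.replicate b (sr 1)

/-- Two neighbouring reflections. -/
def mirrorPair (n : ℕ) : Set (DihedralGroup n) := {sr 0, sr 1}

lemma mirrors_add (a b c d : ℕ) : mirrors n a b + mirrors n c d = mirrors n (a + c) (b + d) := by
  simp only [mirrors, Multiset.replicate_add]; abel

@[simp] lemma card_mirrors (a b : ℕ) : Multiset.card (mirrors n a b) = a + b := by simp [mirrors]

lemma seqOn_mirrors (a b : ℕ) : SeqOn (mirrorPair n) (mirrors n a b) := by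
  intro g hg
  rcases Multiset.mem_add.1 hg with hg | hg
  · exact Or.inl (Multiset.eq_of_mem_replicate hg)
  · exact Or.inr (Multiset.eq_of_mem_replicate hg)

lemma exists_eq_mirrors {S : Multiset (DihedralGroup n)} (h : SeqOn (mirrorPair n) S) :
    ∃ a b, S = mirrors n a b :=
  exists_eq_replicate_add_replicate h

lemma exists_mirrors_of_add_eq {A B : Multiset (DihedralGroup n)} {a b : ℕ}
    (h : mirrors n a b = A + B) : ∃ c d e f, A = mirrors n c d ∧ B = mirrors n e f := by
  obtain ⟨c, d, hA⟩ := exists_eq_mirrors (n := n) (S := A)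
    fun g hg => seqOn_mirrors a b g (h ▸ Multiset.mem_add.2 (Or.inl hg))
  obtain ⟨e, f, hB⟩ := exists_eq_mirrors (n := n) (S := B)
    fun g hg => seqOn_mirrors a b g (h ▸ Multiset.mem_add.2 (Or.inr hg))
  exact ⟨c, d, e, f, hA, hB⟩

lemma mirrors_inj (hn : 1 < n) {a b c d : ℕ} :
    mirrors n a b = mirrors n c d ↔ a = c ∧ b = d := by
  have : Fact (1 < n) := ⟨hn⟩
  refine ⟨fun h => ?_, fun h => by rw [h.1, h.2]⟩
  have h0 := congrArg (Multiset.count (sr 0)) h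
  have h1 := congrArg (Multiset.count (sr 1)) h
  simpa [mirrors, Multiset.count_replicate] using And.intro h0 h1

lemma mirrors_eq_zero {a b : ℕ} : mirrors n a b = 0 ↔ a = 0 ∧ b = 0 := by
  rw [← Multiset.card_eq_zero, card_mirrors]; omega

lemma mirrors_eq_assemble (a b : ℕ) : mirrors n a b =
    assemble 0 (Multiset.replicate a 0 + Multiset.replicate b 1) := by
  simp [mirrors, assemble]

lemma isProductOne_mirrors_iff (hn : 1 < n) (hodd : Odd n) {a b : ℕ} :
    IsProductOne (mirrors n a b) ↔
      (a % 2 = 0 ∧ b % 2 = 0) ∨ (a % 2 = 1 ∧ b % 2 = 1 ∧ n ≤ a ∧ n ≤ b) := by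
  constructor
  · intro h
    obtain ⟨P, Q, R₁, R₂, hR, hF, -, hc, hs⟩ := h.exists_split
    rw [mirrors_eq_assemble, rot_assemble] at hR
    rw [mirrors_eq_assemble, refl_assemble] at hF
    obtain ⟨rfl, rfl⟩ := add_eq_zero.1 hR.symm
    have hmem : ∀ x ∈ P + Q, x = 0 ∨ x = 1 := by
      intro x hx
      rw [← hF] at hx
      exact (Multiset.mem_add.1 hx).imp Multiset.eq_of_mem_replicate Multiset.eq_of_mem_replicate
    obtain ⟨p₀, p₁, rfl⟩ := exists_eq_replicate_add_replicate
      fun x hx => hmem x (Multiset.mem_add.2 (Or.inl hx))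
    obtain ⟨q₀, q₁, rfl⟩ := exists_eq_replicate_add_replicate
      fun x hx => hmem x (Multiset.mem_add.2 (Or.inr hx))
    have hab : a = p₀ + q₀ ∧ b = p₁ + q₁ := by
      have : Fact (1 < n) := ⟨hn⟩
      have h0 := congrArg (Multiset.count 0) hF
      have h1 := congrArg (Multiset.count 1) hF
      simpa [Multiset.count_replicate] using And.intro h0 h1
    have hmod : p₁ ≡ q₁ [MOD n] := by
      rw [← ZMod.natCast_eq_natCast_iff]
      simpa using hs
    simp only [Multiset.card_add, Multiset.card_replicate] at hc
    rcases lt_trichotomy p₁ q₁ with hlt | heq | hlt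
    · have := Nat.le_of_dvd (by omega) ((Nat.modEq_iff_dvd' hlt.le).1 hmod)
      omega
    · omega
    · have := Nat.le_of_dvd (by omega) ((Nat.modEq_iff_dvd' hlt.le).1 hmod.symm)
      omega
  · have heven : ∀ c d : ℕ, IsProductOne (mirrors n (2 * c) (2 * d)) := by
      intro c d
      have h := isProductOne_assemble (n := n) (R₁ := 0) (R₂ := 0)
        (P := Multiset.replicate c 0 + Multiset.replicate d 1)
        (Q := Multiset.replicate c 0 + Multiset.replicate d 1) (fun _ => rfl) rfl rfl
      rwa [assemble_add, ← mirrors_eq_assemble, mirrors_add, ← two_mul, ← two_mul] at h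
    have hbase : IsProductOne (mirrors n n n) := by
      have h := isProductOne_assemble (n := n) (R₁ := 0) (R₂ := 0)
        (P := Multiset.replicate 0 0 + Multiset.replicate n 1)
        (Q := Multiset.replicate n 0 + Multiset.replicate 0 1) (fun _ => rfl) (by simp) (by simp)
      rwa [assemble_add, ← mirrors_eq_assemble, ← mirrors_eq_assemble, mirrors_add, zero_add,
        add_zero] at h
    have := Nat.odd_iff.1 hodd
    rintro (⟨ha, hb⟩ | ⟨ha, hb, hna, hnb⟩)
    · convert heven (a / 2) (b / 2) using 2 <;> omega
    · convert hbase.add (heven ((a - n) / 2) ((b - n) / 2)) using 1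
      rw [mirrors_add]
      congr 1 <;> omega

lemma isAtomSeq_mirrors_iff (hn : 3 ≤ n) (hodd : Odd n) {a b : ℕ} :
    IsAtomSeq (mirrors n a b) ↔ (a = 2 ∧ b = 0) ∨ (a = 0 ∧ b = 2) ∨ (a = n ∧ b = n) := by
  have hn1 : 1 < n := by omega
  have hmod := Nat.odd_iff.1 hodd
  constructor
  · rintro ⟨h0, h1, hmin⟩
    rw [isProductOne_mirrors_iff hn1 hodd] at h1
    rw [Ne, mirrors_eq_zero] at h0
    have key : ∀ c d e f : ℕ, a = c + e → b = d + f → IsProductOne (mirrors n c d) →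
        IsProductOne (mirrors n e f) → (c = 0 ∧ d = 0) ∨ (e = 0 ∧ f = 0) := by
      rintro c d e f rfl rfl hc he
      simpa only [mirrors_eq_zero] using hmin _ _ (mirrors_add c d e f).symm hc he
    simp only [isProductOne_mirrors_iff hn1 hodd] at key
    rcases h1 with h1 | h1
    · rcases Nat.eq_zero_or_pos a with ha | ha
      · have := key 0 2 0 (b - 2)
        omega
      · have := key 2 0 (a - 2) b
        omega
    · have := key n n (a - n) (b - n)
      omega
  · intro h
    refine ⟨by rw [Ne, mirrors_eq_zero]; omega,
      (isProductOne_mirrors_iff hn1 hodd).2 (by omega), ?_⟩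
    intro A B hAB hA hB
    obtain ⟨c, d, e, f, rfl, rfl⟩ := exists_mirrors_of_add_eq hAB
    rw [mirrors_add, mirrors_inj hn1] at hAB
    rw [isProductOne_mirrors_iff hn1 hodd] at hA hB
    simp only [mirrors_eq_zero]
    omega

lemma exists_length_eq (hn : 3 ≤ n) (hodd : Odd n) {z : Multiset (Multiset (DihedralGroup n))} :
    ∀ {a b : ℕ}, IsFactorization (mirrors n a b) z → ∃ k ≤ Multiset.card z,
      2 * Multiset.card z + (2 * n - 2) * k = a + b ∧ k % 2 = a % 2 := by
  have hmod := Nat.odd_iff.1 hodd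
  induction z using Multiset.induction_on with
  | empty =>
    intro a b h
    obtain ⟨rfl, rfl⟩ := mirrors_eq_zero.1 h.2.symm
    exact ⟨0, by simp⟩
  | cons U z ih =>
    intro a b h
    have hsum := h.2
    rw [Multiset.sum_cons] at hsum
    obtain ⟨c, d, e, f, rfl, hz⟩ := exists_mirrors_of_add_eq hsum.symm
    obtain ⟨k, hk, hke, hkm⟩ := ih ⟨fun V hV => h.1 V (Multiset.mem_cons_of_mem hV), hz⟩
    rw [hz, mirrors_add, mirrors_inj (by omega)] at hsum
    rw [Multiset.card_cons]
    rcases (isAtomSeq_mirrors_iff hn hodd).1 (h.1 _ (Multiset.mem_cons_self _ _)) with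
      hU | hU | hU
    · exact ⟨k, by omega, by omega, by omega⟩
    · exact ⟨k, by omega, by omega, by omega⟩
    · exact ⟨k + 1, by omega, by rw [mul_add_one (2 * n - 2)]; omega, by omega⟩

lemma add_le_of_mem_lengths (hn : 3 ≤ n) (hodd : Odd n) {a b k l : ℕ}
    (hk : k ∈ lengthsOn Set.univ (mirrors n a b)) (hl : l ∈ lengthsOn Set.univ (mirrors n a b))
    (hkl : k < l) : k + (2 * n - 2) ≤ l := by
  obtain ⟨z, rfl, hz⟩ := mem_lengthsOn_univ.1 hk
  obtain ⟨w, rfl, hw⟩ := mem_lengthsOn_univ.1 hl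
  obtain ⟨i, -, hi, him⟩ := exists_length_eq hn hodd hz
  obtain ⟨j, -, hj, hjm⟩ := exists_length_eq hn hodd hw
  have hji : j < i := by
    by_contra! hle
    have := Nat.mul_le_mul_left (2 * n - 2) hle
    omega
  have := Nat.mul_le_mul_left (2 * n - 2) (show j + 2 ≤ i by omega)
  rw [mul_add] at this
  omega

lemma le_of_mem_lengths (hn : 3 ≤ n) (hodd : Odd n) {a b k : ℕ}
    (hk : k ∈ lengthsOn Set.univ (mirrors n a b)) : 2 * k ≤ a + b ∧ a + b ≤ 2 * n * k := by
  obtain ⟨z, rfl, hz⟩ := mem_lengthsOn_univ.1 hk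
  obtain ⟨i, hi, hie, -⟩ := exists_length_eq hn hodd hz
  refine ⟨by omega, ?_⟩
  have h1 := Nat.mul_le_mul_left (2 * n - 2) hi
  have h2 : 2 * n * Multiset.card z = 2 * Multiset.card z + (2 * n - 2) * Multiset.card z := by
    rw [← add_mul]; congr 1; omega
  omega

lemma two_mem_lengths (hn : 3 ≤ n) (hodd : Odd n) :
    2 ∈ lengthsOn Set.univ (mirrors n (2 * n) (2 * n)) := by
  refine mem_lengthsOn_univ.2 ⟨Multiset.replicate 2 (mirrors n n n), by simp, ?_, ?_⟩
  · intro U hU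
    rw [Multiset.eq_of_mem_replicate hU]
    exact (isAtomSeq_mirrors_iff hn hodd).2 (by omega)
  · rw [Multiset.sum_replicate, two_nsmul, mirrors_add, two_mul]

lemma nsmul_mirrors (m a b : ℕ) : m • mirrors n a b = mirrors n (m * a) (m * b) := by
  induction m with
  | zero => simp [mirrors]
  | succ m ih => rw [succ_nsmul, ih, mirrors_add, add_one_mul, add_one_mul]

/-- The squares of the two reflections, each repeated `m` times. -/
def mirrorSquares (n m : ℕ) : Multiset (Multiset (DihedralGroup n)) :=
  Multiset.replicate m (mirrors n 2 0) + Multiset.replicate m (mirrors n 0 2)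

lemma sum_mirrorSquares (m : ℕ) : (mirrorSquares n m).sum = mirrors n (m * 2) (m * 2) := by
  simp [mirrorSquares, nsmul_mirrors, mirrors_add]

lemma eq_of_mem_mirrorSquares {m : ℕ} {U : Multiset (DihedralGroup n)}
    (hU : U ∈ mirrorSquares n m) : U = mirrors n 2 0 ∨ U = mirrors n 0 2 :=
  (Multiset.mem_add.1 hU).imp Multiset.eq_of_mem_replicate Multiset.eq_of_mem_replicate

lemma isAtomSeq_of_mem_mirrorSquares (hn : 3 ≤ n) (hodd : Odd n) {m : ℕ}
    {U : Multiset (DihedralGroup n)} (hU : U ∈ mirrorSquares n m) : IsAtomSeq U := by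
  rcases eq_of_mem_mirrorSquares hU with rfl | rfl <;>
    exact (isAtomSeq_mirrors_iff hn hodd).2 (by omega)

lemma two_mul_mem_lengths (hn : 3 ≤ n) (hodd : Odd n) :
    2 * n ∈ lengthsOn Set.univ (mirrors n (2 * n) (2 * n)) := by
  refine mem_lengthsOn_univ.2 ⟨mirrorSquares n n, by simp [mirrorSquares]; omega,
    fun U hU => isAtomSeq_of_mem_mirrorSquares hn hodd hU, ?_⟩
  rw [sum_mirrorSquares, mul_comm]

lemma mem_distances (hn : 3 ≤ n) (hodd : Odd n) :
    2 * n - 2 ∈ distancesOf (lengthsOn Set.univ (mirrors n (2 * n) (2 * n))) := by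
  refine ⟨by omega, 2, two_mem_lengths hn hodd, ?_, fun b hb hlt => ?_⟩
  · rw [show 2 + (2 * n - 2) = 2 * n by omega]
    exact two_mul_mem_lengths hn hodd
  · have := add_le_of_mem_lengths hn hodd (two_mem_lengths hn hodd) hb hlt.1
    omega

lemma isProductOne_mirrors_two_mul (hn : 3 ≤ n) (hodd : Odd n) :
    IsProductOne (mirrors n (2 * n) (2 * n)) :=
  (isProductOne_mirrors_iff (by omega) hodd).2 (by omega)

lemma mem_deltaOn_mirrorPair (hn : 3 ≤ n) (hodd : Odd n) :
    2 * n - 2 ∈ DeltaOn (mirrorPair n) :=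
  ⟨_, seqOn_mirrors _ _, isProductOne_mirrors_two_mul hn hodd, by
    rw [lengthsOn_eq (seqOn_mirrors _ _)]; exact mem_distances hn hodd⟩

lemma sInf_deltaOn_mirrorPair (hn : 3 ≤ n) (hodd : Odd n) :
    sInf (DeltaOn (mirrorPair n)) = 2 * n - 2 := by
  refine IsLeast.csInf_eq ⟨mem_deltaOn_mirrorPair hn hodd, ?_⟩
  rintro d ⟨A, hA, -, hd0, k, hk, hkd, -⟩
  obtain ⟨a, b, rfl⟩ := exists_eq_mirrors hA
  rw [lengthsOn_eq hA] at hk hkd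
  have := add_le_of_mem_lengths hn hodd hk hkd (by omega)
  omega

lemma davenport_eq (hn : 3 ≤ n) (hodd : Odd n) : Davenport (DihedralGroup n) = 2 * n := by
  have : NeZero n := ⟨by omega⟩
  refine IsGreatest.csSup_eq ⟨⟨mirrors n n n, ⟨fun _ _ => trivial, ?_⟩, ?_⟩, ?_⟩
  · exact (isAtomSeq_mirrors_iff hn hodd).2 (by omega)
  · rw [card_mirrors, two_mul]
  · rintro k ⟨S, hS, rfl⟩
    exact hS.2.card_le.trans_eq natCard_dihedral

lemma elasticity_le (hn : 3 ≤ n) (hodd : Odd n) (a b : ℕ) :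
    elasticity (lengthsOn Set.univ (mirrors n a b)) ≤ n := by
  unfold elasticity
  split_ifs with h
  · have hbdd : BddAbove (lengthsOn Set.univ (mirrors n a b) ∩ {k | 0 < k}) :=
      ⟨a + b, fun k hk => by have := (le_of_mem_lengths hn hodd hk.1).1; omega⟩
    have hmax := Nat.sSup_mem h hbdd
    have hmin := Nat.sInf_mem h
    have h1 := (le_of_mem_lengths hn hodd hmax.1).1
    have h2 := (le_of_mem_lengths hn hodd hmin.1).2
    rw [div_le_iff₀ (by exact_mod_cast hmin.2)]
    norm_cast
    rw [mul_assoc] at h2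
    omega
  · exact_mod_cast (by omega : 1 ≤ n)

lemma elasticity_mirrors (hn : 3 ≤ n) (hodd : Odd n) :
    elasticity (lengthsOn Set.univ (mirrors n (2 * n) (2 * n))) = n := by
  have hinf : sInf (lengthsOn Set.univ (mirrors n (2 * n) (2 * n)) ∩ {k | 0 < k}) = 2 := by
    refine IsLeast.csInf_eq ⟨⟨two_mem_lengths hn hodd, two_pos (α := ℕ)⟩, fun k hk => ?_⟩
    have h := (le_of_mem_lengths hn hodd hk.1).2
    exact Nat.le_of_mul_le_mul_left (by linarith) (show 0 < 2 * n by omega)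
  have hsup : sSup (lengthsOn Set.univ (mirrors n (2 * n) (2 * n)) ∩ {k | 0 < k}) = 2 * n := by
    refine IsGreatest.csSup_eq ⟨⟨two_mul_mem_lengths hn hodd, ?_⟩, fun k hk => ?_⟩
    · show 0 < 2 * n
      omega
    · have h := (le_of_mem_lengths hn hodd hk.1).1
      omega
  rw [elasticity, if_pos ⟨2, two_mem_lengths hn hodd, two_pos (α := ℕ)⟩, hinf, hsup]
  push_cast
  ring

lemma rhoOn_mirrorPair (hn : 3 ≤ n) (hodd : Odd n) : rhoOn (mirrorPair n) = n := by
  refine IsGreatest.csSup_eq ⟨⟨mirrors n (2 * n) (2 * n), seqOn_mirrors _ _,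
    isProductOne_mirrors_two_mul hn hodd, ?_⟩, ?_⟩
  · rw [lengthsOn_eq (seqOn_mirrors _ _), elasticity_mirrors hn hodd]
    simp
  · rintro x ⟨A, hA, -, rfl⟩
    obtain ⟨a, b, rfl⟩ := exists_eq_mirrors hA
    rw [lengthsOn_eq hA]
    exact_mod_cast elasticity_le hn hodd a b

lemma card_eq_of_le_mirrorSquares {m : ℕ} {t : Multiset (Multiset (DihedralGroup n))}
    (ht : t ≤ mirrorSquares n m) :
    ∃ a b, t.sum = mirrors n (2 * a) (2 * b) ∧ Multiset.card t = a + b := by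
  obtain ⟨a, b, rfl⟩ := exists_eq_replicate_add_replicate
    fun U hU => eq_of_mem_mirrorSquares (Multiset.mem_of_le ht hU)
  exact ⟨a, b, by simp [nsmul_mirrors, mirrors_add, mul_comm], by simp⟩

lemma le_omegaAt (hn : 3 ≤ n) (hodd : Odd n) :
    ((2 * n : ℕ) : ℕ∞) ≤ omegaAt (mirrors n n n) := by
  have hmod := Nat.odd_iff.1 hodd
  refine le_sInf fun N hN => ?_
  obtain ⟨t, ht, htN, C, hC, htC⟩ := hN (mirrorSquares n n)
    (fun U hU => (isAtomSeq_of_mem_mirrorSquares hn hodd hU).2.1)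
    ⟨mirrors n n n, (isProductOne_mirrors_iff (by omega) hodd).2 (by omega), by
      rw [sum_mirrorSquares, mirrors_add, mul_two]⟩
  refine le_trans ?_ htN
  obtain ⟨a, b, hab, hcard⟩ := card_eq_of_le_mirrorSquares ht
  rw [hab] at htC
  obtain ⟨-, -, e, f, -, rfl⟩ := exists_mirrors_of_add_eq htC
  rw [mirrors_add, mirrors_inj (by omega)] at htC
  rw [isProductOne_mirrors_iff (by omega) hodd] at hC
  exact_mod_cast (by omega : 2 * n ≤ Multiset.card t)

lemma omegaInv_eq (hn : 3 ≤ n) (hodd : Odd n) :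
    omegaInv (DihedralGroup n) = ((2 * n : ℕ) : ℕ∞) := by
  have : NeZero n := ⟨by omega⟩
  refine le_antisymm (iSup₂_le fun U hU => sInf_le fun f hf hdvd => ?_)
    ((le_omegaAt hn hodd).trans (le_iSup₂_of_le (mirrors n n n)
      ((isAtomSeq_mirrors_iff hn hodd).2 (by omega)) le_rfl))
  obtain ⟨t, ht, htn, htd⟩ := exists_small_subproduct hodd hU hf hdvd
  exact ⟨t, ht, by exact_mod_cast htn, htd⟩

lemma connected_dihedral [NeZero n] (hodd : Odd n) (A : Multiset (DihedralGroup n)) :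
    ∀ z z', IsFactorization A z → IsFactorization A z' → Connected A ((2 * n : ℕ) : ℕ∞) z z' :=
  connected_of_omega (fun _ hU _ hf hdvd => exists_small_subproduct hodd hU hf hdvd) A

lemma catenaryDegree_eq (hn : 3 ≤ n) (hodd : Odd n) :
    catenaryDegree (DihedralGroup n) = ((2 * n : ℕ) : ℕ∞) := by
  have : NeZero n := ⟨by omega⟩
  refine le_antisymm (iSup₂_le fun A _ => sInf_le (connected_dihedral hodd A)) ?_
  refine le_iSup₂_of_le (mirrors n (2 * n) (2 * n)) (isProductOne_mirrors_two_mul hn hodd)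
    (le_sInf fun N hN => ?_)
  have h := distance_add_two_le hN (mem_distances hn hodd)
  rwa [show 2 * n - 2 + 2 = 2 * n by omega] at h

lemma le_of_mem_delta [NeZero n] (hodd : Odd n) {d : ℕ} (hd : d ∈ Delta (DihedralGroup n)) :
    d ≤ 2 * n - 2 := by
  obtain ⟨A, -, -, hd⟩ := hd
  have h := distance_add_two_le (connected_dihedral hodd A) hd
  have : d + 2 ≤ 2 * n := by exact_mod_cast h
  omega

lemma sInf_deltaOn_le [NeZero n] (hodd : Odd n) (G₀ : Set (DihedralGroup n)) :
    sInf (DeltaOn G₀) ≤ 2 * n - 2 := by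
  rcases (DeltaOn G₀).eq_empty_or_nonempty with h | h
  · simp [h]
  · exact le_of_mem_delta hodd (deltaOn_subset G₀ (Nat.sInf_mem h))

end DihedralOmega

open ProductOne in
/-- Let `G` be a dihedral group of order `2n`, `n ≥ 3` odd. Then
`2 + max Δ*_ρ(G) = 2 + max Δ*(G) = 2 + max Δ(G) = c(G) = ω(G) = 2n = D(G) = |G|`. -/
theorem chain_of_invariants_dihedral (n : ℕ) (hn : 3 ≤ n) (hodd : Odd n) :
    2 + sSup (DeltaRhoStar (DihedralGroup n)) = 2 * n ∧
    2 + sSup (DeltaStar (DihedralGroup n)) = 2 * n ∧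
    2 + sSup (Delta (DihedralGroup n)) = 2 * n ∧
    catenaryDegree (DihedralGroup n) = ((2 * n : ℕ) : ℕ∞) ∧
    omegaInv (DihedralGroup n) = ((2 * n : ℕ) : ℕ∞) ∧
    Davenport (DihedralGroup n) = 2 * n ∧
    Nat.card (DihedralGroup n) = 2 * n := by
  have : NeZero n := ⟨by omega⟩
  have hinf := (DihedralOmega.sInf_deltaOn_mirrorPair hn hodd).symm
  have hmem := DihedralOmega.mem_deltaOn_mirrorPair hn hodd
  have hadd : ∀ {L : Set ℕ}, IsGreatest L (2 * n - 2) → 2 + sSup L = 2 * n := by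
    intro L hL
    rw [hL.csSup_eq]
    omega
  refine ⟨hadd ⟨⟨_, ?_, hinf⟩, ?_⟩, hadd ⟨⟨_, ⟨_, hmem⟩, hinf⟩, ?_⟩,
    hadd ⟨DihedralOmega.deltaOn_subset _ hmem, fun d hd => DihedralOmega.le_of_mem_delta hodd hd⟩,
    DihedralOmega.catenaryDegree_eq hn hodd, DihedralOmega.omegaInv_eq hn hodd,
    DihedralOmega.davenport_eq hn hodd, DihedralOmega.natCard_dihedral⟩
  · rw [DihedralOmega.rhoOn_mirrorPair hn hodd, DihedralOmega.davenport_eq hn hodd]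
    push_cast
    ring
  · rintro d ⟨G₀, -, rfl⟩
    exact DihedralOmega.sInf_deltaOn_le hodd G₀
  · rintro d ⟨G₀, -, rfl⟩
    exact DihedralOmega.sInf_deltaOn_le hodd G₀
end

section
/- Let G be a finite group with |G| ≥ 3. Then max Δ*(G) ≤ D(G) − 2. -/
namespace ProductOne

theorem IsProductOne.exists_list_prod_eq_inv {G : Type*} [Group G] {g : G} {S : Multiset G}
    (h : IsProductOne (g ::ₘ S)) : ∃ l : List G, (l : Multiset G) = S ∧ l.prod = g⁻¹ := by
  obtain ⟨l, hl, hp⟩ := h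
  have hg : g ∈ l := by
    rw [← Multiset.mem_coe, hl]
    exact Multiset.mem_cons_self g S
  obtain ⟨a, b, rfl⟩ := List.append_of_mem hg
  refine ⟨b ++ a, ?_, ?_⟩
  · have h1 : ((a ++ g :: b : List G) : Multiset G) = g ::ₘ ((b ++ a : List G) : Multiset G) := by
      rw [Multiset.cons_coe, Multiset.coe_eq_coe]
      exact List.perm_middle.trans (List.perm_append_comm.cons g)
    rw [h1] at hl
    exact (Multiset.cons_inj_right g).1 hl
  · simp only [List.prod_append, List.prod_cons] at hp ⊢
    rw [eq_inv_iff_mul_eq_one, mul_assoc, mul_eq_one_iff_eq_inv']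
    exact eq_inv_of_mul_eq_one_left (by rw [mul_assoc]; exact hp)

/-- If a product-one sequence is `g` followed by `S`, then `ord(g)` copies of `S` form a
product-one sequence. -/
theorem IsProductOne.orderOf_nsmul {G : Type*} [Group G] {g : G} {S : Multiset G}
    (h : IsProductOne (g ::ₘ S)) : IsProductOne (orderOf g • S) := by
  obtain ⟨l, rfl, hp⟩ := h.exists_list_prod_eq_inv
  have key : ∀ n : ℕ, ∃ l' : List G, (l' : Multiset G) = n • (l : Multiset G) ∧
      l'.prod = g⁻¹ ^ n := by
    intro n
    induction n with
    | zero => exact ⟨[], by simp⟩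
    | succ n ih =>
      obtain ⟨l', h1, h2⟩ := ih
      exact ⟨l' ++ l, by rw [← Multiset.coe_add, h1, succ_nsmul],
        by rw [List.prod_append, h2, hp, pow_succ]⟩
  obtain ⟨l', h1, h2⟩ := key (orderOf g)
  exact ⟨l', h1, by rw [h2, inv_pow, pow_orderOf_eq_one, inv_one]⟩

theorem exists_factorization {G : Type*} [Group G] (G₀ : Set G) (A : Multiset G)
    (hA : SeqOn G₀ A) (hp : IsProductOne A) :
    ∃ f : Multiset (Multiset G), (∀ U ∈ f, IsAtomSeqOn G₀ U) ∧ f.sum = A := by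
  induction hn : Multiset.card A using Nat.strong_induction_on generalizing A with
  | _ n ih =>
    by_cases h0 : A = 0
    · exact ⟨0, by simp, by simp [h0]⟩
    by_cases hat : IsAtomSeq A
    · exact ⟨{A}, by simpa using ⟨hA, hat⟩, by simp⟩
    simp only [IsAtomSeq, not_and, not_forall, not_or] at hat
    obtain ⟨B, C, rfl, hB, hC, hB0, hC0⟩ := hat h0 hp
    have hB1 := Multiset.card_pos.2 hB0
    have hC1 := Multiset.card_pos.2 hC0
    rw [Multiset.card_add] at hn
    obtain ⟨f, hf, rfl⟩ := ih _ (by omega) B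
      (fun g hg => hA g (Multiset.mem_add.2 (Or.inl hg))) hB rfl
    obtain ⟨f', hf', rfl⟩ := ih _ (by omega) C
      (fun g hg => hA g (Multiset.mem_add.2 (Or.inr hg))) hC rfl
    refine ⟨f + f', fun U hU => ?_, by simp⟩
    exact (Multiset.mem_add.1 hU).elim (hf U) (hf' U)

theorem IsAtomSeq.card_le_s4 {G : Type*} [Group G] [Finite G] {S : Multiset G} (hS : IsAtomSeq S) :
    Multiset.card S ≤ Nat.card G := by
  obtain ⟨-, ⟨l, rfl, hl⟩, hmin⟩ := hS
  by_contra! hlt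
  rw [Multiset.coe_card] at hlt
  have : Fintype G := Fintype.ofFinite G
  rw [Nat.card_eq_fintype_card] at hlt
  obtain ⟨i, j, hij, he⟩ := Fintype.exists_ne_map_eq_of_card_lt
    (fun i : Fin l.length => (l.take i).prod) (by simpa using hlt)
  wlog hlt' : i < j generalizing i j
  · exact this j i hij.symm he.symm (lt_of_le_of_ne (not_lt.1 hlt') hij.symm)
  have hij' : (i : ℕ) < j := hlt'
  have hj := j.2
  have hdec : l.take j = l.take i ++ (l.take j).drop i := by
    conv_lhs => rw [← List.take_append_drop i (l.take j), List.take_take, min_eq_left hij'.le]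
  have hmid : ((l.take j).drop i).prod = 1 := by
    have h1 := congrArg List.prod hdec
    rw [List.prod_append] at h1
    rw [he] at h1
    exact left_eq_mul.1 h1
  have hsplit := List.take_append_drop j l
  have hout : (l.take i ++ l.drop j).prod = 1 := by
    rw [List.prod_append]
    rw [he, ← List.prod_append, hsplit, hl]
  have hsum : (l : Multiset G) =
      ((l.take j).drop i : List G) + ((l.take i ++ l.drop j : List G) : Multiset G) := by
    rw [Multiset.coe_add, Multiset.coe_eq_coe]
    conv_lhs => rw [← hsplit, hdec]
    rw [List.append_assoc]
    exact List.perm_append_comm_assoc _ _ _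
  rcases hmin _ _ hsum ⟨_, rfl, hmid⟩ ⟨_, rfl, hout⟩ with h | h
  · have := congrArg Multiset.card h
    simp at this
    omega
  · have := congrArg Multiset.card h
    simp at this
    omega

theorem IsAtomSeq.card_le_davenport {G : Type*} [Group G] [Finite G] {S : Multiset G}
    (hS : IsAtomSeq S) : Multiset.card S ≤ Davenport G := by
  refine le_csSup ⟨Nat.card G, ?_⟩ ⟨S, ⟨fun _ _ => Set.mem_univ _, hS⟩, rfl⟩
  rintro k ⟨T, hT, rfl⟩
  exact hT.2.card_le_s4

theorem isAtomSeq_replicate_orderOf {G : Type*} [Group G] [Finite G] (g : G) :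
    IsAtomSeq (Multiset.replicate (orderOf g) g) := by
  refine ⟨fun h => ?_, ⟨List.replicate (orderOf g) g, rfl, by simp [pow_orderOf_eq_one]⟩, ?_⟩
  · have := congrArg Multiset.card h
    simp only [Multiset.card_replicate, Multiset.card_zero] at this
    exact (orderOf_pos g).ne' this
  · intro A B hAB hA _
    have hle : A ≤ Multiset.replicate (orderOf g) g := hAB ▸ Multiset.le_add_right A B
    obtain ⟨m, hm, rfl⟩ := Multiset.le_replicate_iff.1 hle
    obtain ⟨l, hl, hp⟩ := hA
    rw [← Multiset.coe_replicate, Multiset.coe_eq_coe, List.perm_replicate] at hl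
    rw [hl, List.prod_replicate] at hp
    have hc := congrArg Multiset.card hAB
    simp only [Multiset.card_replicate, Multiset.card_add] at hc
    rcases Nat.eq_zero_or_pos m with h0 | h0
    · left; simp [h0]
    · right
      have := Nat.le_of_dvd h0 (orderOf_dvd_of_pow_eq_one hp)
      exact Multiset.card_eq_zero.1 (by omega)

theorem IsAtomSeq.eq_singleton_one {G : Type*} [Group G] {U : Multiset G}
    (hU : IsAtomSeq U) (h : (1 : G) ∈ U) : U = {1} := by
  obtain ⟨S, rfl⟩ := Multiset.exists_cons_of_mem h
  obtain ⟨l, hl, hp⟩ := hU.2.1.exists_list_prod_eq_inv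
  rcases hU.2.2 {1} S (Multiset.singleton_add 1 S).symm ⟨[1], rfl, by simp⟩
    ⟨l, hl, by simpa using hp⟩ with h' | h'
  · simp at h'
  · simp [h']

theorem crossNumber_add {G : Type*} [Group G] (S T : Multiset G) :
    crossNumber (S + T) = crossNumber S + crossNumber T := by
  simp [crossNumber]

theorem crossNumber_nsmul {G : Type*} [Group G] (n : ℕ) (S : Multiset G) :
    crossNumber (n • S) = n * crossNumber S := by
  simp [crossNumber, Multiset.map_nsmul, Multiset.sum_nsmul]

theorem crossNumber_multiset_sum {G : Type*} [Group G] (f : Multiset (Multiset G)) :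
    crossNumber f.sum = (f.map crossNumber).sum := by
  induction f using Multiset.induction_on with
  | empty => simp [crossNumber]
  | cons U f ih => simp [crossNumber_add, ih]

theorem crossNumber_replicate_orderOf {G : Type*} [Group G] [Finite G] (g : G) :
    crossNumber (Multiset.replicate (orderOf g) g) = 1 := by
  have h : (orderOf g : ℚ) ≠ 0 := by exact_mod_cast (orderOf_pos g).ne'
  simp [crossNumber, h]

theorem sInf_deltaOn_add_le {G : Type*} [Group G] {G₀ : Set G} {A : Multiset G}
    (hA : SeqOn G₀ A) (hp : IsProductOne A) {a b : ℕ} (ha : a ∈ lengthsOn G₀ A)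
    (hb : b ∈ lengthsOn G₀ A) (hab : a < b) : sInf (DeltaOn G₀) + a ≤ b := by
  classical
  have hex : ∃ c, c ∈ lengthsOn G₀ A ∧ a < c := ⟨b, hb, hab⟩
  have hc := Nat.find_spec hex
  have hcb := Nat.find_min' hex ⟨hb, hab⟩
  have hmem : Nat.find hex - a ∈ DeltaOn G₀ := by
    refine ⟨A, hA, hp, by omega, a, ha, ?_, ?_⟩
    · rw [Nat.add_sub_cancel' hc.2.le]
      exact hc.1
    · rintro x hx ⟨h1, h2⟩
      exact Nat.find_min hex (by omega) ⟨hx, h1⟩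
  have := Nat.sInf_le hmem
  omega

/-- For an atom `U` over `G₀` consisting of `g` followed by `S`, the sequence `ord(g) • S` factors
into atoms over `G₀`; the number of factors plus one is a length of `ord(g) • U`. -/
theorem IsAtomSeqOn.exists_factorization_orderOf_nsmul {G : Type*} [Group G] [Finite G]
    {G₀ : Set G} {g : G} {S : Multiset G} (hU : IsAtomSeqOn G₀ (g ::ₘ S)) :
    ∃ f : Multiset (Multiset G), (∀ W ∈ f, IsAtomSeqOn G₀ W) ∧ f.sum = orderOf g • S ∧
      (f.map crossNumber).sum = orderOf g * crossNumber (g ::ₘ S) - 1 ∧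
      (Multiset.card f + 1 < orderOf g →
        sInf (DeltaOn G₀) + (Multiset.card f + 1) ≤ orderOf g) ∧
      (orderOf g < Multiset.card f + 1 →
        sInf (DeltaOn G₀) + orderOf g ≤ Multiset.card f + 1) := by
  have hg : g ∈ G₀ := hU.1 g (Multiset.mem_cons_self g S)
  have hS : SeqOn G₀ (orderOf g • S) := fun x hx =>
    hU.1 x (Multiset.mem_cons_of_mem (Multiset.mem_of_mem_nsmul hx))
  obtain ⟨f, hf, hsum⟩ := exists_factorization G₀ _ hS hU.2.2.1.orderOf_nsmul
  have hdec : orderOf g • (g ::ₘ S) = Multiset.replicate (orderOf g) g + orderOf g • S := by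
    rw [← Multiset.singleton_add, nsmul_add, Multiset.nsmul_singleton]
  have hseq : SeqOn G₀ (orderOf g • (g ::ₘ S)) := fun x hx =>
    hU.1 x (Multiset.mem_of_mem_nsmul hx)
  have hone : IsProductOne (orderOf g • (g ::ₘ S)) := by
    obtain ⟨l, hl, hp⟩ := (isAtomSeq_replicate_orderOf g).2.1
    obtain ⟨l', hl', hp'⟩ := hU.2.2.1.orderOf_nsmul
    exact ⟨l ++ l', by rw [← Multiset.coe_add, hl, hl', hdec], by simp [hp, hp']⟩
  have hn : orderOf g ∈ lengthsOn G₀ (orderOf g • (g ::ₘ S)) := by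
    refine ⟨Multiset.replicate (orderOf g) (g ::ₘ S), by simp, fun W hW => ?_, by simp⟩
    rw [Multiset.eq_of_mem_replicate hW]
    exact hU
  have hr : Multiset.card f + 1 ∈ lengthsOn G₀ (orderOf g • (g ::ₘ S)) := by
    refine ⟨Multiset.replicate (orderOf g) g ::ₘ f, by simp, fun W hW => ?_, ?_⟩
    · rcases Multiset.mem_cons.1 hW with rfl | hW
      · refine ⟨fun x hx => ?_, isAtomSeq_replicate_orderOf g⟩
        rw [Multiset.eq_of_mem_replicate hx]
        exact hg
      · exact hf W hW
    · rw [Multiset.sum_cons, hsum, hdec]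
  refine ⟨f, hf, hsum, ?_, sInf_deltaOn_add_le hseq hone hr hn,
    sInf_deltaOn_add_le hseq hone hn hr⟩
  rw [← crossNumber_multiset_sum, hsum, ← crossNumber_nsmul, hdec, crossNumber_add,
    crossNumber_replicate_orderOf]
  ring

theorem finite_setOf_isAtomSeqOn {G : Type*} [Group G] [Finite G] (G₀ : Set G) :
    {U : Multiset G | IsAtomSeqOn G₀ U}.Finite := by
  have : Fintype G := Fintype.ofFinite G
  classical
  refine (Set.finite_Iic (Nat.card G • (Finset.univ : Finset G).val)).subset fun U hU => ?_
  rw [Set.mem_Iic, Multiset.le_iff_count]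
  intro a
  rw [Multiset.count_nsmul, Multiset.count_eq_one_of_mem Finset.univ.nodup (Finset.mem_univ a),
    mul_one]
  exact (Multiset.count_le_card a U).trans hU.2.card_le_s4

theorem one_le_crossNumber {G : Type*} [Group G] [Finite G] {G₀ : Set G}
    (hd : Davenport G ≤ sInf (DeltaOn G₀) + 1) {V : Multiset G} (hV : IsAtomSeqOn G₀ V) :
    1 ≤ crossNumber V := by
  obtain ⟨U, hU, hmin⟩ := Set.exists_min_image _ crossNumber (finite_setOf_isAtomSeqOn G₀) ⟨V, hV⟩
  refine le_trans ?_ (hmin V hV)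
  obtain ⟨g, hgU⟩ := Multiset.exists_mem_of_ne_zero hU.2.1
  obtain ⟨S, rfl⟩ := Multiset.exists_cons_of_mem hgU
  obtain ⟨f, hf, hfS, hk, hlow, -⟩ := hU.exists_factorization_orderOf_nsmul
  have hn : orderOf g ≤ Davenport G := by
    simpa using (isAtomSeq_replicate_orderOf g).card_le_davenport
  have hsum := Multiset.card_nsmul_le_sum (s := f.map crossNumber)
    (a := crossNumber (g ::ₘ S)) (by
      intro x hx
      obtain ⟨W, hW, rfl⟩ := Multiset.mem_map.1 hx
      exact hmin W (hf W hW))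
  rw [hk, Multiset.card_map, nsmul_eq_mul] at hsum
  have hpos : 0 ≤ crossNumber (g ::ₘ S) := by
    refine Multiset.sum_nonneg fun x hx => ?_
    obtain ⟨y, -, rfl⟩ := Multiset.mem_map.1 hx
    positivity
  by_cases h : Multiset.card f + 1 < orderOf g
  · have hf0 : f = 0 := Multiset.card_eq_zero.1 (by have := hlow h; omega)
    rw [hf0, Multiset.sum_zero] at hfS
    have hS : Multiset.card S = 0 := by
      have h1 := congrArg Multiset.card hfS
      simp only [Multiset.card_zero, Multiset.card_nsmul, zero_eq_mul] at h1
      exact h1.resolve_left (orderOf_pos g).ne'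
    obtain ⟨l, hl, hp⟩ := hU.2.2.1.exists_list_prod_eq_inv
    rw [Multiset.card_eq_zero.1 hS, Multiset.coe_eq_zero] at hl
    have hg : g = 1 := by simpa [hl, eq_comm] using hp
    rw [hg, orderOf_one] at h
    omega
  · have h' : (orderOf g : ℚ) ≤ Multiset.card f + 1 := by exact_mod_cast not_lt.1 h
    nlinarith

theorem crossNumber_eq_one {G : Type*} [Group G] [Finite G] {G₀ : Set G}
    (hd : Davenport G ≤ sInf (DeltaOn G₀) + 1) {V : Multiset G} (hV : IsAtomSeqOn G₀ V) :
    crossNumber V = 1 := by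
  refine le_antisymm ?_ (one_le_crossNumber hd hV)
  obtain ⟨U, hU, hmax⟩ := Set.exists_max_image _ crossNumber (finite_setOf_isAtomSeqOn G₀) ⟨V, hV⟩
  refine (hmax V hV).trans ?_
  obtain ⟨g, hgU, hgmin⟩ := Set.exists_min_image {x | x ∈ U} orderOf (Set.toFinite _)
    (Multiset.exists_mem_of_ne_zero hU.2.1)
  have hcard : orderOf g * crossNumber U ≤ Davenport G := by
    have hn : (0 : ℚ) < orderOf g := by exact_mod_cast orderOf_pos g
    have hsum := Multiset.sum_le_card_nsmul (U.map fun x => (1 : ℚ) / (orderOf x : ℚ))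
      (1 / (orderOf g : ℚ)) (by
        intro x hx
        obtain ⟨y, hy, rfl⟩ := Multiset.mem_map.1 hx
        exact one_div_le_one_div_of_le hn (by exact_mod_cast hgmin y hy))
    rw [Multiset.card_map, nsmul_eq_mul, mul_one_div, le_div_iff₀ hn, mul_comm] at hsum
    exact hsum.trans (by exact_mod_cast hU.2.card_le_davenport)
  obtain ⟨S, rfl⟩ := Multiset.exists_cons_of_mem hgU
  obtain ⟨f, hf, -, hk, -, hup⟩ := hU.exists_factorization_orderOf_nsmul
  by_cases h : orderOf g < Multiset.card f + 1
  · have hsum := Multiset.card_nsmul_le_sum (s := f.map crossNumber) (a := 1) (by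
      intro x hx
      obtain ⟨W, hW, rfl⟩ := Multiset.mem_map.1 hx
      exact one_le_crossNumber hd (hf W hW))
    rw [hk, Multiset.card_map, nsmul_eq_mul, mul_one] at hsum
    have h1 : Multiset.card f + 1 ≤ Davenport G := by
      have : ((Multiset.card f + 1 : ℕ) : ℚ) ≤ Davenport G := by push_cast; linarith
      exact_mod_cast this
    have h2 : orderOf g = 1 := by
      have := orderOf_pos g
      have := hup h
      omega
    rw [orderOf_eq_one_iff] at h2
    rw [hU.2.eq_singleton_one (h2 ▸ hgU)]
    simp [crossNumber]
  · have hsum := Multiset.sum_le_card_nsmul (f.map crossNumber) (crossNumber (g ::ₘ S)) (by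
      intro x hx
      obtain ⟨W, hW, rfl⟩ := Multiset.mem_map.1 hx
      exact hmax W (hf W hW))
    rw [hk, Multiset.card_map, nsmul_eq_mul] at hsum
    have h' : (Multiset.card f : ℚ) + 1 ≤ orderOf g := by exact_mod_cast not_lt.1 h
    have hpos := one_le_crossNumber hd hU
    nlinarith

end ProductOne

open ProductOne in
/-- Let `G` be a finite group with `|G| ≥ 3`.
Then `max Δ*(G) ≤ D(G) - 2`. -/
theorem max_deltaStar_le (G : Type*) [Group G] [Finite G] (hG : 3 ≤ Nat.card G) :
    sSup (DeltaStar G) ≤ Davenport G - 2 := by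
  refine csSup_le' ?_
  rintro _ ⟨G₀, hne, rfl⟩
  obtain ⟨A, -, -, hpos, a, ⟨f, hfc, hf, hfA⟩, ⟨f', hfc', hf', hfA'⟩, -⟩ := Nat.sInf_mem hne
  by_contra! hlt
  have hd : Davenport G ≤ sInf (DeltaOn G₀) + 1 := by omega
  have key : ∀ f : Multiset (Multiset G), (∀ U ∈ f, IsAtomSeqOn G₀ U) →
      crossNumber f.sum = Multiset.card f := by
    intro f hf
    rw [crossNumber_multiset_sum,
      Multiset.map_congr rfl (fun U hU => crossNumber_eq_one hd (hf U hU))]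
    simp
  have h1 := key f hf
  have h2 := key f' hf'
  rw [hfA] at h1
  rw [hfA', h1] at h2
  have h3 : Multiset.card f = Multiset.card f' := by exact_mod_cast h2
  omega
end
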